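/- arXiv:2001.02481 — 3 statements merged into one kernel-verified Lean document; each statement's English description precedes it below -/
import Mathlib

section
/- For all integers c ≥ 2 and r ≥ 1, the Carlson–Savage graph Γ(c, r) has a reversible pebbling (placing a pebble on every sink at some point) of space at most r·(log(c·r) + 3); that is, the reversible pebbling price of Γ(c, r) is at most r·(log(c·r) + 3). -/
open MvPolynomial

/-- A finite directed graph. -/
structure FinDigraph where
  V : Type
  [instFintype : Fintype V]
  Edge : V → V → Prop

attribute [instance] FinDigraph.instFintype

namespace FinDigraph

/-- The set of (immediate) predecessors of a vertex. -/
def pred (G : FinDigraph) (v : G.V) : Set G.V := {u | G.Edge u v}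

/-- A directed graph is acyclic if no vertex reaches itself by a nonempty path. -/
def Acyclic (G : FinDigraph) : Prop := ∀ v, ¬ Relation.TransGen G.Edge v v

/-- A sink is a vertex with no outgoing edge. -/
def IsSink (G : FinDigraph) (z : G.V) : Prop := ∀ u, ¬ G.Edge z u

/-- `z` is the unique sink of `G`. -/
def UniqueSink (G : FinDigraph) (z : G.V) : Prop :=
  G.IsSink z ∧ ∀ v, G.IsSink v → v = z

/-- One legal move of the reversible pebble game: place a pebble on a vertex all of whose
predecessors are pebbled, or remove a pebble from such a vertex. -/
def RevMove (G : FinDigraph) (P Q : Set G.V) : Prop :=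
  ∃ v, G.pred v ⊆ P ∧
    ((v ∉ P ∧ Q = insert v P) ∨ (v ∈ P ∧ Q = P \ {v}))

/-- One legal move of the standard pebble game: place a pebble on a vertex all of whose
predecessors are pebbled, or remove a pebble from an arbitrary vertex. -/
def StdMove (G : FinDigraph) (P Q : Set G.V) : Prop :=
  (∃ v, G.pred v ⊆ P ∧ v ∉ P ∧ Q = insert v P) ∨ (∃ v, v ∈ P ∧ Q = P \ {v})

/-- A reversible pebbling of `G` (with sink `z`) with time `t`. -/
def IsRevPebbling (G : FinDigraph) (z : G.V) (t : ℕ) (P : ℕ → Set G.V) : Prop :=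
  P 0 = ∅ ∧ P t = ∅ ∧ (∃ i ≤ t, z ∈ P i) ∧ ∀ i < t, G.RevMove (P i) (P (i + 1))

/-- A standard pebbling of `G` (with sink `z`) with time `t`. -/
def IsStdPebbling (G : FinDigraph) (z : G.V) (t : ℕ) (P : ℕ → Set G.V) : Prop :=
  P 0 = ∅ ∧ P t = ∅ ∧ (∃ i ≤ t, z ∈ P i) ∧ ∀ i < t, G.StdMove (P i) (P (i + 1))

/-- The space of a pebbling: the maximal number of pebbles in any configuration. -/
noncomputable def space (G : FinDigraph) (t : ℕ) (P : ℕ → Set G.V) : ℕ :=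
  (Finset.range (t + 1)).sup fun i => (P i).ncard

end FinDigraph

namespace FinDigraph

/-- A reversible pebbling of a multi-sink DAG `G` with sink set `Z`: at some point each sink
carries a pebble. -/
def IsRevPebblingMulti (G : FinDigraph) (Z : Set G.V) (t : ℕ) (P : ℕ → Set G.V) : Prop :=
  P 0 = ∅ ∧ P t = ∅ ∧ (∀ z ∈ Z, ∃ i ≤ t, z ∈ P i) ∧ ∀ i < t, G.RevMove (P i) (P (i + 1))

end FinDigraph

/-- Vertices of the pyramid graph of height `h`: `v_{i,j}` for `0 ≤ i ≤ h`, `0 ≤ j ≤ h - i`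
(0-indexed columns). -/
def PyrV (h : ℕ) : Type := Σ i : Fin (h + 1), Fin (h + 1 - i.1)

instance (h : ℕ) : Fintype (PyrV h) := by unfold PyrV; infer_instance

/-- Edges of the pyramid graph: from `v_{i,j}` to `v_{i+1,j}` and from `v_{i,j+1}` to
`v_{i+1,j}`. -/
def pyrEdge (h : ℕ) (a b : PyrV h) : Prop :=
  b.1.1 = a.1.1 + 1 ∧ (b.2.1 = a.2.1 ∨ b.2.1 + 1 = a.2.1)

/-- The (unique) sink `v_{h,0}` of the pyramid graph of height `h`. -/
def pyrSink (h : ℕ) : PyrV h := ⟨⟨h, Nat.lt_succ_self h⟩, ⟨0, by omega⟩⟩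

/-- Vertices of the Carlson–Savage graph: `CSV c r` is the vertex set of `Γ(c, r + 1)`.
`Γ(c, 1)` consists of 2 sources and `c` sinks; `Γ(c, r + 2)` consists of `c` pyramids of
height `r + 1`, a copy of `Γ(c, r + 1)`, and `c` spines, each a path of `r + 1` sections of
`2c` vertices. -/
def CSV (c : ℕ) : ℕ → Type
  | 0 => Fin 2 ⊕ Fin c
  | r + 1 => (Fin c × PyrV (r + 1)) ⊕ CSV c r ⊕ (Fin c × Fin ((r + 1) * (2 * c)))

instance instFintypeCSV (c : ℕ) : ∀ r, Fintype (CSV c r)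
  | 0 => inferInstanceAs (Fintype (Fin 2 ⊕ Fin c))
  | r + 1 =>
    letI := instFintypeCSV c r
    inferInstanceAs (Fintype ((Fin c × PyrV (r + 1)) ⊕ CSV c r ⊕ (Fin c × Fin ((r + 1) * (2 * c)))))

/-- The `j`-th sink of the Carlson–Savage graph `Γ(c, r + 1)`: in the base case the `j`-th
sink vertex, and otherwise the final vertex of the `j`-th spine. -/
def CSsink (c : ℕ) : (r : ℕ) → Fin c → CSV c r
  | 0, j => Sum.inr j
  | r + 1, j => Sum.inr (Sum.inr (j, ⟨(r + 1) * (2 * c) - 1,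
      Nat.sub_lt (Nat.mul_pos (Nat.succ_pos r) (Nat.mul_pos two_pos j.pos)) Nat.one_pos⟩))

/-- Edges of the Carlson–Savage graph `Γ(c, r + 1)`. In the recursive case: pyramid edges,
edges of the inner copy `Γ(c, r + 1)`, spine path edges, edges from the sink of the `j`-th
pyramid to the `j`-th vertex of each section of each spine, and edges from the `j`-th sink of
the inner copy to the `(c + j)`-th vertex of each section of each spine. -/
def CSEdge (c : ℕ) : (r : ℕ) → CSV c r → CSV c r → Prop
  | 0, a, b => ∃ (i : Fin 2) (j : Fin c), a = Sum.inl i ∧ b = Sum.inr j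
  | r + 1, a, b =>
      (∃ (i : Fin c) (p q : PyrV (r + 1)), pyrEdge (r + 1) p q ∧
        a = Sum.inl (i, p) ∧ b = Sum.inl (i, q)) ∨
      (∃ u v : CSV c r, CSEdge c r u v ∧
        a = Sum.inr (Sum.inl u) ∧ b = Sum.inr (Sum.inl v)) ∨
      (∃ (i : Fin c) (k k' : Fin ((r + 1) * (2 * c))), k'.1 = k.1 + 1 ∧
        a = Sum.inr (Sum.inr (i, k)) ∧ b = Sum.inr (Sum.inr (i, k'))) ∨
      (∃ (j i : Fin c) (k : Fin ((r + 1) * (2 * c))), k.1 % (2 * c) = j.1 ∧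
        a = Sum.inl (j, pyrSink (r + 1)) ∧ b = Sum.inr (Sum.inr (i, k))) ∨
      (∃ (j i : Fin c) (k : Fin ((r + 1) * (2 * c))), k.1 % (2 * c) = c + j.1 ∧
        a = Sum.inr (Sum.inl (CSsink c r j)) ∧ b = Sum.inr (Sum.inr (i, k)))

/-- The Carlson–Savage graph `Γ(c, r + 1)` as a finite directed graph. -/
def CSGraph (c r : ℕ) : FinDigraph := { V := CSV c r, Edge := CSEdge c r }

namespace CSProof

/-- Reachability by reversible moves through configurations of size at most `s`. -/
def Reach (G : FinDigraph) (s : ℕ) : Set G.V → Set G.V → Prop :=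
  Relation.ReflTransGen fun P Q => G.RevMove P Q ∧ P.ncard ≤ s ∧ Q.ncard ≤ s

theorem revMove_symm {G : FinDigraph} (hG : ∀ v, ¬ G.Edge v v) {P Q : Set G.V}
    (h : G.RevMove P Q) : G.RevMove Q P := by
  obtain ⟨v, hp, h⟩ := h
  have hv : v ∉ G.pred v := hG v
  rcases h with ⟨h1, rfl⟩ | ⟨h1, rfl⟩
  · refine ⟨v, hp.trans (Set.subset_insert _ _), Or.inr ⟨Set.mem_insert _ _, ?_⟩⟩
    simp [h1]
  · refine ⟨v, ?_, Or.inl ⟨by simp, ?_⟩⟩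
    · intro u hu
      refine ⟨hp hu, ?_⟩
      rintro rfl
      exact hv hu
    · simp [Set.insert_eq_of_mem h1]

theorem Reach.symm {G : FinDigraph} (hG : ∀ v, ¬ G.Edge v v) {s : ℕ} {P Q : Set G.V}
    (h : Reach G s P Q) : Reach G s Q P := by
  induction h with
  | refl => exact Relation.ReflTransGen.refl
  | tail _ h1 ih =>
    exact Relation.ReflTransGen.head ⟨revMove_symm hG h1.1, h1.2.2, h1.2.1⟩ ih

theorem Reach.mono {G : FinDigraph} {s s' : ℕ} (hs : s ≤ s') {P Q : Set G.V}
    (h : Reach G s P Q) : Reach G s' P Q := by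
  induction h with
  | refl => exact Relation.ReflTransGen.refl
  | tail _ h1 ih =>
    exact Relation.ReflTransGen.tail ih ⟨h1.1, h1.2.1.trans hs, h1.2.2.trans hs⟩

theorem Reach.trans {G : FinDigraph} {s : ℕ} {P Q R : Set G.V}
    (h : Reach G s P Q) (h' : Reach G s Q R) : Reach G s P R :=
  Relation.ReflTransGen.trans h h'

theorem reach_place {G : FinDigraph} {s : ℕ} {P : Set G.V} {v : G.V} (hv : v ∉ P)
    (hp : G.pred v ⊆ P) (hs : P.ncard + 1 ≤ s) : Reach G s P (insert v P) := by
  refine Relation.ReflTransGen.single ⟨⟨v, hp, Or.inl ⟨hv, rfl⟩⟩, by omega, ?_⟩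
  exact (Set.ncard_insert_le _ _).trans hs

/-- Toggle `v` using one auxiliary toggled vertex `x`. -/
theorem tog_one {G : FinDigraph} (hG : ∀ v, ¬ G.Edge v v) {s : ℕ} (hs : 1 ≤ s) {P : Set G.V}
    {x v : G.V} (hv : v ∉ P) (_hx : x ∉ P) (hxv : x ≠ v)
    (hp : G.pred v ⊆ insert x P)
    (h1 : Reach G (P.ncard + s) P (insert x P))
    (h2 : Reach G (P.ncard + 1 + s) (insert v P) (insert x (insert v P))) :
    Reach G (P.ncard + 1 + s) P (insert v P) := by
  refine (h1.mono (by omega)).trans (Reach.trans ?_ (h2.symm hG))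
  rw [Set.insert_comm]
  refine reach_place ?_ hp ?_
  · simp [hv, hxv.symm]
  · have := Set.ncard_insert_le x P
    omega

/-- Toggle `v` using two auxiliary toggled vertices. -/
theorem tog_two {G : FinDigraph} (hG : ∀ v, ¬ G.Edge v v) {s : ℕ} (hs : 1 ≤ s) {P D : Set G.V}
    {a b v : G.V} (hv : v ∉ P) (ha : a ∉ P) (hb : b ∉ P) (hav : a ≠ v) (hbv : b ≠ v) (hab : a ≠ b)
    (hp : G.pred v ⊆ {a, b}) (haD : a ∉ D) (hvD : v ∉ D) (hPD : ∀ x ∈ D, x ∉ P)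
    (h1 : ∀ Q : Set G.V, (∀ x ∈ D, x ∉ Q) → a ∉ Q → Reach G (Q.ncard + s) Q (insert a Q))
    (h2 : ∀ Q : Set G.V, (∀ x ∈ D, x ∉ Q) → b ∉ Q → Reach G (Q.ncard + s) Q (insert b Q)) :
    Reach G (P.ncard + 2 + s) P (insert v P) := by
  have e1 : ∀ (y : G.V) (Q : Set G.V), y ∉ D → (∀ x ∈ D, x ∉ Q) → ∀ x ∈ D, x ∉ insert y Q := by
    intro y Q hy hQ x hx hxy
    rcases hxy with rfl | h
    · exact hy hx
    · exact hQ x hx h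
  have na : (insert a P).ncard = P.ncard + 1 := Set.ncard_insert_of_notMem ha
  have nv : (insert v P).ncard = P.ncard + 1 := Set.ncard_insert_of_notMem hv
  have nva : (insert v (insert a P)).ncard = P.ncard + 2 := by
    rw [Set.ncard_insert_of_notMem (by simp [hv, hav.symm]), na]
  have A := h1 P hPD ha
  have B := tog_one hG hs (P := insert a P) (x := b) (v := v) (by simp [hv, hav.symm])
    (by simp [hb, hab.symm]) hbv
    (by
      intro x hx
      rcases hp hx with rfl | h
      · simp
      · rw [Set.mem_singleton_iff] at h; simp [h])
    (h2 _ (e1 _ _ haD hPD) (by simp [hb, hab.symm]))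
    ((h2 _ (e1 _ _ hvD (e1 _ _ haD hPD)) (by simp [hb, hab.symm, hbv])).mono (by omega))
  have C := h1 _ (e1 _ _ hvD hPD) (by simp [ha, hav])
  rw [Set.insert_comm] at C
  exact (A.mono (by omega)).trans ((B.mono (by omega)).trans ((C.symm hG).mono (by omega)))

/-- Transfer along an embedding closed under predecessors. -/
theorem Reach.map {G H : FinDigraph} (f : H.V → G.V) (hf : Function.Injective f)
    (hp : ∀ v, G.pred (f v) ⊆ Set.image f (H.pred v)) {s : ℕ} {A B : Set H.V} (h : Reach H s A B)
    {P : Set G.V} (hP : ∀ v, f v ∉ P) :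
    Reach G (P.ncard + s) (P ∪ Set.image f A) (P ∪ Set.image f B) := by
  have hb : ∀ C : Set H.V, C.ncard ≤ s → (P ∪ Set.image f C).ncard ≤ P.ncard + s := by
    intro C hC
    have h1 := Set.ncard_union_le P (Set.image f C)
    have h2 := Set.ncard_image_of_injective C hf
    omega
  suffices hstep : ∀ C D : Set H.V, (H.RevMove C D ∧ C.ncard ≤ s ∧ D.ncard ≤ s) →
      (G.RevMove (P ∪ Set.image f C) (P ∪ Set.image f D) ∧ (P ∪ Set.image f C).ncard ≤ P.ncard + s ∧
        (P ∪ Set.image f D).ncard ≤ P.ncard + s) by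
    induction h with
    | refl => exact Relation.ReflTransGen.refl
    | tail _ h1 ih => exact Relation.ReflTransGen.tail ih (hstep _ _ h1)
  rintro C D ⟨⟨v, hv, hm⟩, hC, hD⟩
  refine ⟨⟨f v, ?_, ?_⟩, hb C hC, hb D hD⟩
  · exact (hp v).trans ((Set.image_mono hv).trans Set.subset_union_right)
  · rcases hm with ⟨h1, rfl⟩ | ⟨h1, rfl⟩
    · left
      refine ⟨?_, ?_⟩
      · simp [hP, hf.eq_iff, h1]
      · simp [Set.image_insert_eq]
    · right
      refine ⟨Or.inr ⟨v, h1, rfl⟩, ?_⟩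
      rw [Set.image_sdiff hf, Set.image_singleton]
      ext y
      simp only [Set.mem_union, Set.mem_sdiff, Set.mem_singleton_iff]
      constructor
      · rintro (h | h)
        · refine ⟨Or.inl h, ?_⟩
          rintro rfl
          exact hP v h
        · exact ⟨Or.inr h.1, h.2⟩
      · rintro ⟨h | h, h'⟩
        · exact Or.inl h
        · exact Or.inr ⟨h, h'⟩

theorem Reach.map_single {G H : FinDigraph} (f : H.V → G.V) (hf : Function.Injective f)
    (hp : ∀ v, G.pred (f v) ⊆ Set.image f (H.pred v)) {s : ℕ} {z : H.V} (h : Reach H s ∅ {z})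
    {P : Set G.V} (hP : ∀ v, f v ∉ P) :
    Reach G (P.ncard + s) P (insert (f z) P) := by
  have := h.map f hf hp hP
  rw [Set.image_empty, Set.union_empty, Set.image_singleton, Set.union_singleton] at this
  exact this

theorem single_conv {G : FinDigraph} {s : ℕ} {z : G.V} (h : Reach G s ∅ (insert z ∅)) :
    Reach G s ∅ {z} := by
  rwa [insert_empty_eq] at h

/-! ### Pyramids -/

/-- The pyramid as a digraph. -/
def PyrGraph (h : ℕ) : FinDigraph := { V := PyrV h, Edge := pyrEdge h }

theorem pyr_irrefl (h : ℕ) (v : (PyrGraph h).V) : ¬ (PyrGraph h).Edge v v := by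
  rintro ⟨h1, _⟩
  omega

theorem pyr_ext {h : ℕ} {a b : PyrV h} (h1 : a.1.1 = b.1.1) (h2 : a.2.1 = b.2.1) : a = b := by
  obtain ⟨⟨i, hi⟩, ⟨j, hj⟩⟩ := a
  obtain ⟨⟨i', hi'⟩, ⟨j', hj'⟩⟩ := b
  simp only at h1 h2
  subst h1
  subst h2
  rfl

theorem pyr_reach (h : ℕ) : ∀ (i : ℕ) (v : PyrV h), v.1.1 = i → ∀ P : Set (PyrV h),
    (∀ x ∈ {x : PyrV h | x.1.1 < i}, x ∉ P) → v ∉ P →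
    Reach (PyrGraph h) (Set.ncard P + (2 * i + 1)) P (insert v P) := by
  intro i
  induction i with
  | zero =>
    intro v hv P hP hvP
    refine reach_place (G := PyrGraph h) hvP ?_ le_rfl
    rintro u ⟨h1, _⟩
    omega
  | succ i ih =>
    intro v hv P hP hvP
    obtain ⟨⟨i', hi⟩, ⟨j, hj⟩⟩ := v
    simp only at hv
    subst hv
    simp only at hj
    let a : PyrV h := ⟨⟨i, by omega⟩, ⟨j, by simp only; omega⟩⟩
    let b : PyrV h := ⟨⟨i, by omega⟩, ⟨j + 1, by simp only; omega⟩⟩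
    have key := tog_two (G := PyrGraph h) (pyr_irrefl h) (s := 2 * i + 1) (by omega) (P := P)
      (D := {x : PyrV h | x.1.1 < i}) (a := a) (b := b) (v := ⟨⟨i + 1, hi⟩, ⟨j, hj⟩⟩) hvP
      (hP a (Nat.lt_succ_self i)) (hP b (Nat.lt_succ_self i))
      (fun e => by
        have := congrArg (fun x : PyrV h => x.1.1) e
        simp [a] at this)
      (fun e => by
        have := congrArg (fun x : PyrV h => x.1.1) e
        simp [b] at this)
      (fun e => by
        have := congrArg (fun x : PyrV h => x.2.1) e
        simp [a, b] at this)
      (by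
        rintro u ⟨h1, h2⟩
        simp only at h1 h2
        rcases h2 with h2 | h2
        · left
          exact pyr_ext (by simp only [a]; omega) (by simp only [a]; omega)
        · right
          exact pyr_ext (by simp only [b]; omega) (by simp only [b]; omega))
      (fun h : i < i => by omega) (fun h : i + 1 < i => by omega)
      (fun x (hx : x.1.1 < i) => hP x (Nat.lt_succ_of_lt hx))
      (fun Q hQ haQ => ih a rfl Q hQ haQ)
      (fun Q hQ haQ => ih b rfl Q hQ haQ)
    exact key.mono (by change Set.ncard P + _ + _ ≤ _; omega)

theorem pyr_sink_reach (h : ℕ) : Reach (PyrGraph h) (2 * h + 1) ∅ {pyrSink h} := by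
  have := pyr_reach h h (pyrSink h) rfl ∅ (by simp) (by simp)
  rw [Set.ncard_empty, Nat.zero_add] at this
  exact single_conv this

/-! ### Carlson–Savage graphs -/

/-- Space bound. -/
def sp (c : ℕ) : ℕ → ℕ
  | 0 => 3
  | r + 1 => sp c r + (Nat.clog 2 ((r + 1) * (2 * c)) + 1)

theorem cs_irrefl (c : ℕ) : ∀ r (v : (CSGraph c r).V), ¬ (CSGraph c r).Edge v v := by
  intro r
  induction r with
  | zero =>
    rintro v ⟨i, j, h1, h2⟩
    rw [h1] at h2
    cases h2
  | succ r ih =>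
    rintro v (⟨i, p, q, h, h1, h2⟩ | ⟨u, w, h, h1, h2⟩ | ⟨i, k, k', h, h1, h2⟩ |
      ⟨j, i, k, h, h1, h2⟩ | ⟨j, i, k, h, h1, h2⟩)
    · rw [h1] at h2
      cases h2
      exact pyr_irrefl _ _ h
    · rw [h1] at h2
      cases h2
      exact ih _ h
    · rw [h1] at h2
      cases h2
      omega
    · rw [h1] at h2
      cases h2
    · rw [h1] at h2
      cases h2

/-- Spine lemma. -/
theorem spine_reach (c r s : ℕ) (hs : 1 ≤ s) (i : Fin c)
    (hx : ∀ q : Fin ((r + 1) * (2 * c)), ∃ x : CSV c (r + 1),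
      (∀ y, x ≠ Sum.inr (Sum.inr y)) ∧
      (∀ u, CSEdge c (r + 1) u (Sum.inr (Sum.inr (i, q))) → u = x ∨
        ∃ q' : Fin ((r + 1) * (2 * c)), q'.1 + 1 = q.1 ∧ u = Sum.inr (Sum.inr (i, q'))) ∧
      ∀ Q : Set (CSV c (r + 1)), (∀ z ∈ Q, ∃ y, z = Sum.inr (Sum.inr y)) →
        Reach (CSGraph c (r + 1)) (Set.ncard Q + s) Q (insert x Q)) :
    ∀ (k a : ℕ) (q : Fin ((r + 1) * (2 * c))), a ≤ q.1 → q.1 + 1 ≤ a + 2 ^ k →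
      ∀ P : Set (CSV c (r + 1)), (∀ z ∈ P, ∃ y, z = Sum.inr (Sum.inr y)) →
      (∀ p : Fin ((r + 1) * (2 * c)), a ≤ p.1 → p.1 ≤ q.1 → Sum.inr (Sum.inr (i, p)) ∉ P) →
      (∀ p : Fin ((r + 1) * (2 * c)), p.1 + 1 = a → Sum.inr (Sum.inr (i, p)) ∈ P) →
      Reach (CSGraph c (r + 1)) (Set.ncard P + (k + 1 + s)) P
        (insert (Sum.inr (Sum.inr (i, q))) P) := by
  have hins : ∀ (P : Set (CSV c (r + 1))) (q : Fin ((r + 1) * (2 * c))),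
      (∀ z ∈ P, ∃ y, z = Sum.inr (Sum.inr y)) →
      ∀ z ∈ insert (Sum.inr (Sum.inr (i, q))) P, ∃ y, z = Sum.inr (Sum.inr y) := by
    rintro P q hP z (rfl | hz)
    · exact ⟨_, rfl⟩
    · exact hP z hz
  intro k
  induction k with
  | zero =>
    intro a q haq hqa P hP hemp hprev
    obtain ⟨x, hx1, hx2, hx3⟩ := hx q
    have hqP := hemp q haq le_rfl
    have hn : (insert (Sum.inr (Sum.inr (i, q))) P : Set (CSV c (r + 1))).ncard
        ≤ Set.ncard P + 1 := Set.ncard_insert_le _ _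
    have key := tog_one (G := CSGraph c (r + 1)) (cs_irrefl c (r + 1)) hs (P := P) (x := x)
      (v := Sum.inr (Sum.inr (i, q))) hqP
      (fun h => by obtain ⟨y, hy⟩ := hP x h; exact hx1 y hy) (hx1 _)
      (by
        intro u hu
        rcases hx2 u hu with h | ⟨q', h1, h2⟩
        · left; exact h
        · right
          rw [h2]
          exact hprev q' (by simp at hqa; omega))
      (hx3 P hP)
      ((hx3 _ (hins P q hP)).mono (by change _ ≤ Set.ncard P + 1 + s; omega))
    exact key.mono (by change Set.ncard P + _ + _ ≤ _; omega)
  | succ k ih =>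
    intro a q haq hqa P hP hemp hprev
    by_cases hle : q.1 + 1 ≤ a + 2 ^ k
    · exact (ih a q haq hle P hP hemp hprev).mono (by omega)
    · have hpos : 0 < 2 ^ k := by positivity
      have h2 : 2 ^ (k + 1) = 2 ^ k + 2 ^ k := by ring
      let m : Fin ((r + 1) * (2 * c)) := ⟨a + 2 ^ k - 1, by have := q.2; omega⟩
      have hm : m.1 = a + 2 ^ k - 1 := rfl
      have hne : ∀ p p' : Fin ((r + 1) * (2 * c)), p.1 ≠ p'.1 →
          (Sum.inr (Sum.inr (i, p)) : CSV c (r + 1)) ≠ Sum.inr (Sum.inr (i, p')) := by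
        intro p p' h e
        cases e
        exact h rfl
      have n1 : (insert (Sum.inr (Sum.inr (i, m))) P : Set (CSV c (r + 1))).ncard
        ≤ Set.ncard P + 1 := Set.ncard_insert_le _ _
      have n2 : (insert (Sum.inr (Sum.inr (i, q))) P : Set (CSV c (r + 1))).ncard
        ≤ Set.ncard P + 1 := Set.ncard_insert_le _ _
      have A := ih a m (by omega) (by omega) P hP
        (fun p h1 h2 => hemp p h1 (by omega)) hprev
      have B := ih (m.1 + 1) q (by omega) (by omega) (insert (Sum.inr (Sum.inr (i, m))) P)
        (hins P m hP)
        (fun p h1 h2 h3 => by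
          rcases h3 with h3 | h3
          · exact hne p m (by omega) h3
          · exact hemp p (by omega) h2 h3)
        (fun p h1 => by
          left
          have : p = m := Fin.ext (by omega)
          rw [this])
      have C := ih a m (by omega) (by omega) (insert (Sum.inr (Sum.inr (i, q))) P)
        (hins P q hP)
        (fun p h1 h2 h3 => by
          rcases h3 with h3 | h3
          · exact hne p q (by omega) h3
          · exact hemp p (by omega) (by omega) h3)
        (fun p h1 => Or.inr (hprev p h1))
      have e : (insert (Sum.inr (Sum.inr (i, m))) (insert (Sum.inr (Sum.inr (i, q))) P) :
          Set (CSV c (r + 1))) = insert (Sum.inr (Sum.inr (i, q)))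
            (insert (Sum.inr (Sum.inr (i, m))) P) := Set.insert_comm _ _ _
      have C' := C.symm (cs_irrefl c (r + 1))
      have B' := B
      erw [← e] at B'
      exact (A.mono (by omega)).trans ((B'.mono (by omega)).trans
        (C'.mono (by omega)))

theorem sp_ge (c : ℕ) (hc : 2 ≤ c) : ∀ r, 2 * r + 3 ≤ sp c r := by
  intro r
  induction r with
  | zero => simp [sp]
  | succ r ih =>
    have : 0 < Nat.clog 2 ((r + 1) * (2 * c)) := Nat.clog_pos (by norm_num) (by nlinarith)
    simp only [sp]
    omega

theorem cs_reach (c : ℕ) (hc : 2 ≤ c) : ∀ (r : ℕ) (j : Fin c),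
    Reach (CSGraph c r) (sp c r) ∅ {CSsink c r j} := by
  intro r
  induction r with
  | zero =>
    intro j
    have hsrc : ∀ (i : Fin 2) (Q : Set (CSGraph c 0).V), (∀ x ∈ (∅ : Set (CSGraph c 0).V), x ∉ Q) →
        (Sum.inl i : CSV c 0) ∉ Q →
        Reach (CSGraph c 0) (Q.ncard + 1) Q (insert (Sum.inl i : CSV c 0) Q) := by
      intro i Q _ h
      refine reach_place h ?_ le_rfl
      rintro u ⟨i, j, h1, h2⟩
      cases h2
    have key := tog_two (G := CSGraph c 0) (cs_irrefl c 0) (s := 1) le_rfl (P := ∅) (D := ∅)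
      (a := (Sum.inl 0 : CSV c 0)) (b := (Sum.inl 1 : CSV c 0)) (v := (Sum.inr j : CSV c 0))
      (Set.notMem_empty _) (Set.notMem_empty _) (Set.notMem_empty _)
      (fun h => by cases h) (fun h => by cases h) (fun h => by cases h)
      (by
        rintro u ⟨i, j, h1, h2⟩
        rw [h1]
        fin_cases i
        · left; rfl
        · right; rfl)
      (Set.notMem_empty _) (Set.notMem_empty _) (by simp) (hsrc 0) (hsrc 1)
    rw [Set.ncard_empty] at key
    exact single_conv key
  | succ r ih =>
    intro j
    have hsp := sp_ge c hc r
    have hLpos : 0 < (r + 1) * (2 * c) := by positivity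
    have key := spine_reach c r (sp c r) (by omega) j ?_ (Nat.clog 2 ((r + 1) * (2 * c))) 0
      ⟨(r + 1) * (2 * c) - 1, by omega⟩ (by omega)
      (by
        have := Nat.le_pow_clog (b := 2) (by norm_num) ((r + 1) * (2 * c))
        simp only
        omega) ∅ (by simp) (fun _ _ _ => Set.notMem_empty _)
      (fun p h => absurd h (by omega))
    · refine Reach.mono (s := Set.ncard (∅ : Set (CSV c (r + 1))) +
        (Nat.clog 2 ((r + 1) * (2 * c)) + 1 + sp c r)) ?_ ?_
      · simp [sp]; omega
      · exact single_conv key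
    · intro q
      have hmod : q.1 % (2 * c) < 2 * c := Nat.mod_lt _ (by omega)
      by_cases hlt : q.1 % (2 * c) < c
      · refine ⟨Sum.inl (⟨q.1 % (2 * c), hlt⟩, pyrSink (r + 1)), (fun y h => by cases h), ?_, ?_⟩
        · rintro u (⟨i, p, q', h, h1, h2⟩ | ⟨u', w, h, h1, h2⟩ | ⟨i, k, k', h, h1, h2⟩ |
            ⟨j', i, k, h, h1, h2⟩ | ⟨j', i, k, h, h1, h2⟩)
          · cases h2
          · cases h2
          · cases h2
            exact Or.inr ⟨k, h.symm, h1⟩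
          · cases h2
            left
            rw [h1]
            have : j' = ⟨q.1 % (2 * c), hlt⟩ := Fin.ext h.symm
            rw [this]
          · cases h2
            omega
        · intro Q hQ
          have := Reach.map_single (G := CSGraph c (r + 1)) (H := PyrGraph (r + 1))
            (fun p => (Sum.inl (⟨q.1 % (2 * c), hlt⟩, p) : CSV c (r + 1)))
            (fun a b hab => by cases hab; rfl)
            (by
              rintro v u (⟨i, p, q', h, h1, h2⟩ | ⟨u', w, h, h1, h2⟩ | ⟨i, k, k', h, h1, h2⟩ |
                ⟨j', i, k, h, h1, h2⟩ | ⟨j', i, k, h, h1, h2⟩)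
              · cases h2
                exact ⟨p, h, h1.symm⟩
              · cases h2
              · cases h2
              · cases h2
              · cases h2)
            (pyr_sink_reach (r + 1)) (P := Q)
            (fun v hv => by obtain ⟨y, hy⟩ := hQ _ hv; cases hy)
          exact this.mono (by change Set.ncard Q + _ ≤ _; omega)
      · refine ⟨Sum.inr (Sum.inl (CSsink c r ⟨q.1 % (2 * c) - c, by omega⟩)),
          (fun y h => by cases h), ?_, ?_⟩
        · rintro u (⟨i, p, q', h, h1, h2⟩ | ⟨u', w, h, h1, h2⟩ | ⟨i, k, k', h, h1, h2⟩ |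
            ⟨j', i, k, h, h1, h2⟩ | ⟨j', i, k, h, h1, h2⟩)
          · cases h2
          · cases h2
          · cases h2
            exact Or.inr ⟨k, h.symm, h1⟩
          · cases h2
            have := j'.2
            omega
          · cases h2
            left
            rw [h1]
            have : j' = ⟨q.1 % (2 * c) - c, by omega⟩ := Fin.ext (by simp only; omega)
            rw [this]
        · intro Q hQ
          exact Reach.map_single (G := CSGraph c (r + 1)) (H := CSGraph c r)
            (fun p => (Sum.inr (Sum.inl p) : CSV c (r + 1)))
            (fun a b hab => by cases hab; rfl)
            (by
              rintro v u (⟨i, p, q', h, h1, h2⟩ | ⟨u', w, h, h1, h2⟩ | ⟨i, k, k', h, h1, h2⟩ |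
                ⟨j', i, k, h, h1, h2⟩ | ⟨j', i, k, h, h1, h2⟩)
              · cases h2
              · cases h2
                exact ⟨u', h, h1.symm⟩
              · cases h2
              · cases h2
              · cases h2)
            (ih _) (P := Q)
            (fun v hv => by obtain ⟨y, hy⟩ := hQ _ hv; cases hy)

/-! ### From reachability to pebblings -/

/-- An explicit sequence of moves. -/
def IsWalk (G : FinDigraph) (s : ℕ) (A B : Set G.V) (t : ℕ) (f : ℕ → Set G.V) : Prop :=
  f 0 = A ∧ f t = B ∧ (∀ i < t, G.RevMove (f i) (f (i + 1))) ∧ ∀ i ≤ t, (f i).ncard ≤ s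

theorem IsWalk.append {G : FinDigraph} {s : ℕ} {A B C : Set G.V} {t t' : ℕ} {f g : ℕ → Set G.V}
    (hf : IsWalk G s A B t f) (hg : IsWalk G s B C t' g) :
    ∃ h, IsWalk G s A C (t + t') h ∧ (∀ i ≤ t, h i = f i) ∧ ∀ i ≤ t', h (t + i) = g i := by
  obtain ⟨f0, ft, fm, fs⟩ := hf
  obtain ⟨g0, gt, gm, gs⟩ := hg
  let h : ℕ → Set G.V := fun i => if i ≤ t then f i else g (i - t)
  have hl : ∀ i ≤ t, h i = f i := fun i hi => if_pos hi
  have hr : ∀ i, h (t + i) = g i := by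
    intro i
    by_cases hi : i = 0
    · subst hi
      rw [hl _ (by omega), g0, ← ft]
      rfl
    · simp only [h]
      rw [if_neg (by omega)]
      congr 1
      omega
  refine ⟨h, ⟨by rw [hl _ (by omega), f0], by rw [hr, gt], ?_, ?_⟩, hl, fun i _ => hr i⟩
  · intro i hi
    by_cases hit : i < t
    · rw [hl _ (by omega), hl _ (by omega)]
      exact fm i hit
    · obtain ⟨k, rfl⟩ : ∃ k, i = t + k := ⟨i - t, by omega⟩
      rw [add_assoc, hr, hr]
      exact gm k (by omega)
  · intro i hi
    by_cases hit : i ≤ t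
    · rw [hl _ hit]
      exact fs i hit
    · obtain ⟨k, rfl⟩ : ∃ k, i = t + k := ⟨i - t, by omega⟩
      rw [hr]
      exact gs k (by omega)

theorem Reach.walk {G : FinDigraph} {s : ℕ} {A B : Set G.V} (h : Reach G s A B)
    (hA : A.ncard ≤ s) : ∃ t f, IsWalk G s A B t f := by
  induction h with
  | refl => exact ⟨0, fun _ => A, rfl, rfl, by simp, by simpa using hA⟩
  | @tail B C _ hBC ih =>
    obtain ⟨t, f, hf⟩ := ih
    have hg : IsWalk G s B C 1 (fun i => if i = 0 then B else C) := by
      refine ⟨rfl, rfl, ?_, ?_⟩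
      · intro i hi
        obtain rfl : i = 0 := by omega
        exact hBC.1
      · intro i _
        by_cases hi : i = 0
        · simpa [hi] using hBC.2.1
        · simpa [hi] using hBC.2.2
    obtain ⟨h, hh, _⟩ := hf.append hg
    exact ⟨_, h, hh⟩

theorem visit_all (c r s : ℕ) (hr : ∀ j : Fin c, Reach (CSGraph c r) s ∅ {CSsink c r j})
    (S : Finset (Fin c)) : ∃ t f, IsWalk (CSGraph c r) s ∅ ∅ t f ∧
      ∀ j ∈ S, ∃ i ≤ t, CSsink c r j ∈ f i := by
  classical
  induction S using Finset.induction_on with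
  | empty => exact ⟨0, fun _ => ∅, ⟨rfl, rfl, by simp, by simp⟩, by simp⟩
  | insert a S _ ih =>
    obtain ⟨t, f, hf, hv⟩ := ih
    obtain ⟨t1, f1, hf1⟩ := (hr a).walk (by simp)
    obtain ⟨t2, f2, hf2⟩ := ((hr a).symm (cs_irrefl c r)).walk (by
      have := hf1.2.2.2 t1 le_rfl
      rwa [hf1.2.1] at this)
    obtain ⟨g, hg, hg1, _⟩ := hf1.append hf2
    obtain ⟨h, hh, h1, h2⟩ := hf.append hg
    refine ⟨_, h, hh, ?_⟩
    intro j hj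
    rcases Finset.mem_insert.1 hj with rfl | hj
    · refine ⟨t + t1, by omega, ?_⟩
      rw [h2 _ (by omega), hg1 _ le_rfl, hf1.2.1]
      rfl
    · obtain ⟨i, hi, hm⟩ := hv j hj
      exact ⟨i, by omega, by rwa [h1 i hi]⟩

theorem sp_le (c : ℕ) (hc : 2 ≤ c) : ∀ r : ℕ,
    (sp c r : ℝ) ≤ ((r : ℝ) + 1) * (Real.logb 2 (c * ((r : ℝ) + 1)) + 3) := by
  have hc' : (2 : ℝ) ≤ c := by exact_mod_cast hc
  intro r
  induction r with
  | zero =>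
    have : 0 ≤ Real.logb 2 c := Real.logb_nonneg (by norm_num) (by linarith)
    simp [sp]
    exact this
  | succ r ih =>
    have hr : (0 : ℝ) ≤ r := Nat.cast_nonneg r
    have hmono : Real.logb 2 (c * ((r : ℝ) + 1)) ≤ Real.logb 2 (c * ((r : ℝ) + 1 + 1)) :=
      Real.logb_le_logb_of_le (by norm_num) (by positivity) (by nlinarith)
    have hlog : (Nat.clog 2 ((r + 1) * (2 * c)) : ℝ) ≤ Real.logb 2 (c * ((r : ℝ) + 1)) + 2 := by
      have hpos : 0 < Nat.clog 2 ((r + 1) * (2 * c)) := Nat.clog_pos (by norm_num) (by nlinarith)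
      have h1 : 2 ^ (Nat.clog 2 ((r + 1) * (2 * c)) - 1) < (r + 1) * (2 * c) :=
        Nat.pow_pred_clog_lt_self (by norm_num) (by nlinarith)
      obtain ⟨k, hk⟩ : ∃ k, Nat.clog 2 ((r + 1) * (2 * c)) = k + 1 :=
        ⟨Nat.clog 2 ((r + 1) * (2 * c)) - 1, by omega⟩
      rw [hk] at h1 ⊢
      simp only [Nat.add_sub_cancel] at h1
      have h2 : ((2 : ℝ) ^ k) ≤ 2 * (c * ((r : ℝ) + 1)) := by
        have : ((2 ^ k : ℕ) : ℝ) ≤ ((r + 1) * (2 * c) : ℕ) := by exact_mod_cast h1.le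
        push_cast at this
        linarith
      have h3 : (k : ℝ) ≤ Real.logb 2 (2 * (c * ((r : ℝ) + 1))) := by
        rw [Real.le_logb_iff_rpow_le (by norm_num) (by positivity), Real.rpow_natCast]
        exact h2
      rw [Real.logb_mul (by norm_num) (by positivity), Real.logb_self_eq_one (by norm_num)] at h3
      push_cast
      linarith
    simp only [sp]
    push_cast
    nlinarith

end CSProof

/-- For all `c ≥ 2` and `r ≥ 1`, the Carlson–Savage graph `Γ(c, r)`
(here `CSGraph c (r - 1)`) has a reversible pebbling, placing a pebble on every sink at some
point, of space at most `r * (log₂(c * r) + 3)`. -/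
theorem carlson_savage_reversible_pebbling_price (c r : ℕ) (hc : 2 ≤ c) (hr : 1 ≤ r) :
    ∃ (t : ℕ) (P : ℕ → Set (CSGraph c (r - 1)).V),
      (CSGraph c (r - 1)).IsRevPebblingMulti (Set.range (CSsink c (r - 1))) t P ∧
      ((CSGraph c (r - 1)).space t P : ℝ) ≤ r * (Real.logb 2 (c * r) + 3) := by
  obtain ⟨r, rfl⟩ : ∃ r', r = r' + 1 := ⟨r - 1, by omega⟩
  obtain ⟨t, f, ⟨h0, ht, hm, hs⟩, hv⟩ :=
    CSProof.visit_all c r (CSProof.sp c r) (CSProof.cs_reach c hc r) Finset.univ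
  refine ⟨t, f, ⟨h0, ht, ?_, hm⟩, ?_⟩
  · rintro z ⟨j, rfl⟩
    exact hv j (Finset.mem_univ j)
  · have h1 : (CSGraph c r).space t f ≤ CSProof.sp c r := by
      refine Finset.sup_le fun i hi => hs i ?_
      have := Finset.mem_range.1 hi
      omega
    have h2 := CSProof.sp_le c hc r
    have h3 : ((CSGraph c r).space t f : ℝ) ≤ CSProof.sp c r := by exact_mod_cast h1
    push_cast
    exact h3.trans h2
end

section
/- There is an absolute constant C such that for every ε with 0 < ε ≤ 1 and all integers c ≥ 2 and r ≥ 1, the Carlson–Savage graph Γ(c, r), with n denoting its number of vertices, has a reversible pebbling (placing a pebble on every sink at some point) with space at most C·ε·2^{1/ε}·(c + r)·log(c·r) and time at most C·n^{1+ε}. -/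
open MvPolynomial

/-! ### Generic walks -/

/-- A walk of `t` steps of `R` through states satisfying `ok`. -/
inductive CSWalk {α : Type} (R : α → α → Prop) (ok : α → Prop) : ℕ → α → α → Prop
  | nil (a : α) : ok a → CSWalk R ok 0 a a
  | cons {t : ℕ} {a b d : α} : CSWalk R ok t a b → R b d → ok d → CSWalk R ok (t + 1) a d

namespace CSWalk

variable {α : Type} {R : α → α → Prop} {ok ok' : α → Prop}

theorem ok_left {t : ℕ} {a b : α} (h : CSWalk R ok t a b) : ok a := by
  induction h with
  | nil a h => exact h
  | cons _ _ _ ih => exact ih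

theorem ok_right {t : ℕ} {a b : α} (h : CSWalk R ok t a b) : ok b := by
  cases h with
  | nil _ h => exact h
  | cons _ _ h => exact h

theorem mono (hk : ∀ a, ok a → ok' a) {t : ℕ} {a b : α} (h : CSWalk R ok t a b) :
    CSWalk R ok' t a b := by
  induction h with
  | nil a h => exact nil a (hk _ h)
  | cons _ hr ho ih => exact cons ih hr (hk _ ho)

theorem trans {t t' : ℕ} {a b d : α} (h : CSWalk R ok t a b) (h' : CSWalk R ok t' b d) :
    CSWalk R ok (t + t') a d := by
  induction h' with
  | nil a _ => exact h
  | cons _ hr ho ih => exact cons (ih h) hr ho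

theorem symm (hR : ∀ a b, R a b → R b a) {t : ℕ} {a b : α} (h : CSWalk R ok t a b) :
    CSWalk R ok t b a := by
  induction h with
  | nil a h => exact nil a h
  | cons hw hr ho ih =>
    have h1 := (cons (nil _ ho) (hR _ _ hr) hw.ok_right).trans ih
    rwa [Nat.zero_add, Nat.add_comm] at h1

theorem seq {t : ℕ} {a b : α} (h : CSWalk R ok t a b) :
    ∃ P : ℕ → α, P 0 = a ∧ P t = b ∧ (∀ i < t, R (P i) (P (i + 1))) ∧ ∀ i ≤ t, ok (P i) := by
  induction h with
  | nil a h => exact ⟨fun _ => a, rfl, rfl, by simp, by simpa using h⟩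
  | @cons t a b d hw hr ho ih =>
    obtain ⟨P, h0, h1, h2, h3⟩ := ih
    refine ⟨fun i => if i ≤ t then P i else d, by simpa using h0, by simp, ?_, ?_⟩
    · intro i hi
      rcases Nat.lt_or_ge i t with h | h
      · have : i + 1 ≤ t := h
        simpa [this, h.le] using h2 i h
      · have : i = t := by omega
        subst this
        simpa [h1] using hr
    · intro i hi
      by_cases h : i ≤ t
      · simpa [h] using h3 i h
      · simpa [h] using ho

end CSWalk

/-! ### Reversible pebbling of a line -/

/-- Toggling position `i + 1` of a line while `i` is marked. -/
def LineMove (S S' : Finset ℕ) : Prop :=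
  ∃ i ∈ S, (i + 1 ∉ S ∧ S' = insert (i + 1) S) ∨ (i + 1 ∈ S ∧ S' = S.erase (i + 1))

theorem LineMove.symm (S S' : Finset ℕ) (h : LineMove S S') : LineMove S' S := by
  obtain ⟨i, hi, ⟨h1, rfl⟩ | ⟨h1, rfl⟩⟩ := h
  · exact ⟨i, by simp [hi], Or.inr ⟨by simp, by simp [h1]⟩⟩
  · exact ⟨i, by simp [hi], Or.inl ⟨by simp, by simp [h1]⟩⟩

/-- Bennett's strategy for a line. -/
theorem line_walk (k : ℕ) : ∀ m a L : ℕ, L ≤ k ^ m → ∀ F : Finset ℕ, a ∈ F →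
    (∀ x ∈ F, ¬ (a < x ∧ x ≤ a + L)) →
    ∃ t ≤ 2 ^ m * L,
      CSWalk LineMove (fun S => S.card ≤ F.card + m * k + 1) t F (insert (a + L) F) := by
  intro m
  induction m with
  | zero =>
    intro a L hL F ha hF
    have hL' : L = 0 ∨ L = 1 := by simp at hL; omega
    rcases hL' with rfl | rfl
    · refine ⟨0, by simp, ?_⟩
      simp only [add_zero, Finset.insert_eq_of_mem ha]
      exact CSWalk.nil _ (by omega)
    · have hn : a + 1 ∉ F := fun h => hF _ h ⟨by omega, le_rfl⟩
      exact ⟨1, by simp, CSWalk.cons (CSWalk.nil F (by omega)) ⟨a, ha, Or.inl ⟨hn, rfl⟩⟩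
        (by rw [Finset.card_insert_of_notMem hn]; omega)⟩
  | succ m ih =>
    have inner : ∀ j a L : ℕ, L ≤ j * k ^ m → ∀ F : Finset ℕ, a ∈ F →
        (∀ x ∈ F, ¬ (a < x ∧ x ≤ a + L)) →
        ∃ t ≤ 2 ^ (m + 1) * L,
          CSWalk LineMove (fun S => S.card ≤ F.card + m * k + j + 1) t F (insert (a + L) F) := by
      intro j
      induction j with
      | zero =>
        intro a L hL F ha hF
        have : L = 0 := by simpa using hL
        subst this
        refine ⟨0, by simp, ?_⟩
        simp only [add_zero, Finset.insert_eq_of_mem ha]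
        exact CSWalk.nil _ (by omega)
      | succ j ihj =>
        intro a L hL F ha hF
        rcases le_or_gt L (k ^ m) with hle | hlt
        · obtain ⟨t, ht, w⟩ := ih a L hle F ha hF
          refine ⟨t, ht.trans (Nat.mul_le_mul_right _ (Nat.pow_le_pow_right (by omega) (by omega))),
            w.mono (fun S hS => by omega)⟩
        -- the length of the first piece
        obtain ⟨d, hd, hdL, hrest⟩ : ∃ d, d ≤ k ^ m ∧ d < L ∧ L - d ≤ j * k ^ m := by
          refine ⟨k ^ m, le_rfl, hlt, ?_⟩
          rw [Nat.add_mul, Nat.one_mul] at hL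
          omega
        rcases Nat.eq_zero_or_pos d with rfl | hdpos
        · obtain ⟨t, ht, w⟩ := ihj a L (by simpa using hrest) F ha hF
          exact ⟨t, ht, w.mono (fun S hS => by omega)⟩
        have hn : a + d ∉ F := fun h => hF _ h ⟨by omega, by omega⟩
        have hnL : a + L ∉ F := fun h => hF _ h ⟨by omega, by omega⟩
        obtain ⟨t1, ht1, w1⟩ := ih a d hd F ha (fun x hx h => hF x hx ⟨h.1, by omega⟩)
        obtain ⟨t2, ht2, w2⟩ := ihj (a + d) (L - d) hrest (insert (a + d) F) (by simp) (by
          intro x hx h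
          rcases Finset.mem_insert.1 hx with rfl | hx
          · omega
          · exact hF x hx ⟨by omega, by omega⟩)
        obtain ⟨t3, ht3, w3⟩ := ih a d hd (insert (a + L) F) (by simp [ha]) (by
          intro x hx h
          rcases Finset.mem_insert.1 hx with rfl | hx
          · omega
          · exact hF x hx ⟨by omega, by omega⟩)
        rw [show a + d + (L - d) = a + L by omega, Finset.insert_comm] at w2
        have e1 : (insert (a + d) F).card = F.card + 1 := Finset.card_insert_of_notMem hn
        have e2 : (insert (a + L) F).card = F.card + 1 := Finset.card_insert_of_notMem hnL
        rw [e1] at w2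
        rw [e2] at w3
        refine ⟨t1 + t2 + t3, ?_,
          ((w1.mono (ok' := fun S => S.card ≤ F.card + m * k + (j + 1) + 1)
          (fun S hS => by omega)).trans (w2.mono (fun S hS => by omega))).trans
          ((w3.mono (fun S hS => by omega)).symm LineMove.symm)⟩
        obtain ⟨e, rfl⟩ := Nat.exists_eq_add_of_le hdL.le
        simp only [Nat.add_sub_cancel_left] at ht2
        calc t1 + t2 + t3 ≤ 2 ^ m * d + 2 ^ (m + 1) * e + 2 ^ m * d := by omega
          _ = 2 ^ (m + 1) * (d + e) := by ring
    intro a L hL F ha hF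
    obtain ⟨t, ht, w⟩ := inner k a L (by rwa [pow_succ, mul_comm] at hL) F ha hF
    exact ⟨t, ht, w.mono (fun S hS => by rw [Nat.add_mul]; omega)⟩

/-! ### Standard pebblings and their reversible simulation -/

/-- A standard pebbling in which unneeded pebbles are dropped for free; `t` counts placements. -/
inductive CSRun (G : FinDigraph) (s : ℕ) : ℕ → Set G.V → Set G.V → Prop
  | nil {A B : Set G.V} : B ⊆ A → A.ncard ≤ s → CSRun G s 0 A B
  | cons {t : ℕ} {A B D : Set G.V} (v : G.V) : CSRun G s t A B → G.pred v ⊆ B →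
      D ⊆ insert v B → (insert v B).ncard ≤ s → CSRun G s (t + 1) A D

namespace CSRun

variable {G : FinDigraph} {s s' t t' : ℕ} {A B D : Set G.V}

theorem drop (h : CSRun G s t A B) (hD : D ⊆ B) : CSRun G s t A D := by
  cases h with
  | nil h1 h2 => exact nil (hD.trans h1) h2
  | cons v h1 h2 h3 h4 => exact cons v h1 h2 (hD.trans h3) h4

theorem trans (h : CSRun G s t A B) (h' : CSRun G s t' B D) : CSRun G s (t + t') A D := by
  induction h' with
  | nil h1 h2 => exact h.drop h1
  | cons v h1 h2 h3 h4 ih => exact cons v (ih h) h2 h3 h4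

theorem mono (hs : s ≤ s') (h : CSRun G s t A B) : CSRun G s' t A B := by
  induction h with
  | nil h1 h2 => exact nil h1 (h2.trans hs)
  | cons v h1 h2 h3 h4 ih => exact cons v ih h2 h3 (h4.trans hs)

theorem place (v : G.V) (hv : G.pred v ⊆ A) (hD : D ⊆ insert v A)
    (hs : (insert v A).ncard ≤ s) : CSRun G s 1 A D :=
  cons v (nil le_rfl ((Set.ncard_le_ncard (Set.subset_insert v A) (Set.toFinite _)).trans hs))
    hv hD hs

theorem frame (F : Set G.V) (h : CSRun G s t A B) :
    CSRun G (s + F.ncard) t (A ∪ F) (B ∪ F) := by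
  induction h with
  | nil h1 h2 =>
    exact nil (Set.union_subset_union_left _ h1) ((Set.ncard_union_le _ _).trans (by omega))
  | cons v h1 h2 h3 h4 ih =>
    refine cons v ih (h2.trans Set.subset_union_left) ?_ ?_
    · rw [← Set.insert_union]; exact Set.union_subset_union_left _ h3
    · rw [← Set.insert_union]; exact (Set.ncard_union_le _ _).trans (by omega)

theorem map {G' : FinDigraph} (f : G.V → G'.V)
    (hf : ∀ v, G'.pred (f v) ⊆ f '' (G.pred v)) (h : CSRun G s t A B) :
    CSRun G' s t (f '' A) (f '' B) := by
  induction h with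
  | nil h1 h2 =>
    exact nil (Set.image_mono h1) ((Set.ncard_image_le (Set.toFinite _)).trans h2)
  | cons v h1 h2 h3 h4 ih =>
    refine cons (f v) ih ((hf v).trans (Set.image_mono h2)) ?_ ?_
    · rw [← Set.image_insert_eq]; exact Set.image_mono h3
    · rw [← Set.image_insert_eq]; exact (Set.ncard_image_le (Set.toFinite _)).trans h4

theorem iterate (Q : ℕ → Set G.V) (τ : ℕ → ℕ) (h0 : (Q 0).ncard ≤ s) (T : ℕ)
    (h : ∀ i < T, CSRun G s (τ i) (Q i) (Q (i + 1))) :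
    CSRun G s (∑ i ∈ Finset.range T, τ i) (Q 0) (Q T) := by
  induction T with
  | zero => simpa using nil le_rfl h0
  | succ T ih =>
    rw [Finset.sum_range_succ]
    exact (ih fun i hi => h i (by omega)).trans (h T (by omega))

theorem seq (h : CSRun G s t A B) : ∃ Q : ℕ → Set G.V, Q 0 = A ∧ B ⊆ Q t ∧
    (∀ i, Q (i + 1) ⊆ Q i ∨ ∃ v, G.pred v ⊆ Q i ∧ Q (i + 1) ⊆ insert v (Q i)) ∧
    ∀ i, (Q i).ncard ≤ s := by
  induction h with
  | @nil A B h1 h2 => exact ⟨fun _ => A, rfl, h1, fun _ => Or.inl le_rfl, fun _ => h2⟩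
  | @cons t A B D v h1 h2 h3 h4 ih =>
    obtain ⟨Q, q0, q1, q2, q3⟩ := ih
    refine ⟨fun i => if i ≤ t then Q i else D, by simpa using q0, by simp, ?_, ?_⟩
    · intro i
      rcases lt_trichotomy i t with h | rfl | h
      · have : i + 1 ≤ t := h
        simpa [this, h.le] using q2 i
      · right
        refine ⟨v, by simpa using h2.trans q1, ?_⟩
        simpa using h3.trans (Set.insert_subset_insert q1)
      · left
        simp [show ¬ i ≤ t by omega, show ¬ i + 1 ≤ t by omega]
    · intro i
      by_cases h : i ≤ t
      · simpa [h] using q3 i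
      · simpa [h] using (Set.ncard_le_ncard h3 (Set.toFinite _)).trans h4

end CSRun

/-- One toggle of a checkpoint is at most one reversible move. -/
theorem revMove_of_lineMove {G : FinDigraph} (Q : ℕ → Set G.V)
    (hQ : ∀ i, Q (i + 1) ⊆ Q i ∨ ∃ v, G.pred v ⊆ Q i ∧ Q (i + 1) ⊆ insert v (Q i))
    {S S' : Finset ℕ} (h : LineMove S S') :
    (⋃ i ∈ S', Q i) = (⋃ i ∈ S, Q i) ∨ G.RevMove (⋃ i ∈ S, Q i) (⋃ i ∈ S', Q i) := by
  have key : ∀ (X : Finset ℕ) (i : ℕ), i ∈ X →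
      (⋃ j ∈ insert (i + 1) X, Q j) = (⋃ j ∈ X, Q j) ∨
      ∃ v, G.pred v ⊆ (⋃ j ∈ X, Q j) ∧ v ∉ (⋃ j ∈ X, Q j) ∧
        (⋃ j ∈ insert (i + 1) X, Q j) = insert v (⋃ j ∈ X, Q j) := by
    intro X i hi
    have hsub : Q i ⊆ ⋃ j ∈ X, Q j := Set.subset_biUnion_of_mem (u := fun j => Q j) hi
    rw [Finset.set_biUnion_insert]
    generalize (⋃ j ∈ X, Q j) = U at hsub ⊢
    by_cases hc : Q (i + 1) ⊆ U
    · left; exact Set.union_eq_right.2 hc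
    right
    rcases hQ i with h1 | ⟨v, h1, h2⟩
    · exact absurd (h1.trans hsub) hc
    have h3 : Q (i + 1) ⊆ insert v U := h2.trans (Set.insert_subset_insert hsub)
    have hv : v ∉ U := fun hv => hc (by rwa [Set.insert_eq_of_mem hv] at h3)
    have hv' : v ∈ Q (i + 1) := by
      by_contra hcon
      apply hc
      intro x hx
      rcases h3 hx with rfl | h
      · exact absurd hx hcon
      · exact h
    refine ⟨v, h1.trans hsub, hv, Set.Subset.antisymm (Set.union_subset h3 (Set.subset_insert _ _)) ?_⟩
    exact Set.insert_subset (Or.inl hv') Set.subset_union_right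
  obtain ⟨i, hi, ⟨h1, rfl⟩ | ⟨h1, rfl⟩⟩ := h
  · rcases key S i hi with h | ⟨v, p1, p2, p3⟩
    · exact Or.inl h
    · exact Or.inr ⟨v, p1, Or.inl ⟨p2, p3⟩⟩
  · have hk := key (S.erase (i + 1)) i (by simp [hi])
    rw [Finset.insert_erase h1] at hk
    rcases hk with h | ⟨v, p1, p2, p3⟩
    · exact Or.inl h.symm
    · right
      refine ⟨v, p1.trans (p3 ▸ Set.subset_insert _ _), Or.inr ⟨p3 ▸ Set.mem_insert _ _, ?_⟩⟩
      rw [p3, Set.insert_sdiff_self_of_notMem p2]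

/-- Simulation of a checkpoint strategy by reversible moves. -/
theorem revWalk_of_lineWalk {G : FinDigraph} (Q : ℕ → Set G.V) (s p : ℕ)
    (hQ : ∀ i, Q (i + 1) ⊆ Q i ∨ ∃ v, G.pred v ⊆ Q i ∧ Q (i + 1) ⊆ insert v (Q i))
    (hs : ∀ i, (Q i).ncard ≤ s) {t : ℕ} {S S' : Finset ℕ}
    (h : CSWalk LineMove (fun S => S.card ≤ p) t S S') :
    ∃ t' ≤ t, CSWalk G.RevMove (fun P => P.ncard ≤ p * s) t' (⋃ i ∈ S, Q i) (⋃ i ∈ S', Q i) := by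
  have hcard : ∀ X : Finset ℕ, X.card ≤ p → (⋃ i ∈ X, Q i).ncard ≤ p * s := by
    intro X hX
    refine (Finset.set_ncard_biUnion_le X Q).trans ?_
    exact (Finset.sum_le_card_nsmul X _ s (fun i _ => hs i)).trans (Nat.mul_le_mul_right _ hX)
  induction h with
  | nil a h => exact ⟨0, le_rfl, CSWalk.nil _ (hcard _ h)⟩
  | cons hw hr ho ih =>
    obtain ⟨t', ht', w⟩ := ih
    rcases revMove_of_lineMove Q hQ hr with h | h
    · exact ⟨t', by omega, h ▸ w⟩
    · exact ⟨t' + 1, by omega, CSWalk.cons w h (hcard _ ho)⟩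

/-- Bennett's simulation for pebblings. -/
theorem rev_of_run {G : FinDigraph} {s T : ℕ} {Z : Set G.V} (h : CSRun G s T ∅ Z)
    (k m : ℕ) (hT : T ≤ k ^ m) :
    ∃ (t : ℕ) (P : ℕ → Set G.V), G.IsRevPebblingMulti Z t P ∧
      G.space t P ≤ (m * k + 2) * s ∧ t ≤ 2 * (2 ^ m * T) := by
  obtain ⟨Q, q0, q1, q2, q3⟩ := h.seq
  obtain ⟨t, ht, w⟩ := line_walk k m 0 T hT {0} (by simp) (by simp)
  have w' : CSWalk LineMove (fun S => S.card ≤ m * k + 2) t {0} (insert (0 + T) {0}) :=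
    w.mono (fun S hS => by simp at hS; omega)
  obtain ⟨t1, ht1, v1⟩ := revWalk_of_lineWalk Q s _ q2 q3 w'
  obtain ⟨t2, ht2, v2⟩ := revWalk_of_lineWalk Q s _ q2 q3 (w'.symm LineMove.symm)
  have e0 : (⋃ i ∈ ({0} : Finset ℕ), Q i) = ∅ := by simp [q0]
  have e1 : (⋃ i ∈ (insert (0 + T) {0} : Finset ℕ), Q i) = Q T := by simp [q0]
  rw [e0, e1] at v1 v2
  obtain ⟨P1, a0, a1, a2, a3⟩ := v1.seq
  obtain ⟨P2, b0, b1, b2, b3⟩ := v2.seq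
  have hle : ∀ i, i ≤ t1 → (fun i => if i ≤ t1 then P1 i else P2 (i - t1)) i = P1 i := by
    intro i hi; simp [hi]
  have hge : ∀ i, t1 ≤ i → (fun i => if i ≤ t1 then P1 i else P2 (i - t1)) i = P2 (i - t1) := by
    intro i hi
    rcases hi.eq_or_lt with rfl | h
    · simp [a1, b0]
    · simp [show ¬ i ≤ t1 by omega]
  refine ⟨t1 + t2, fun i => if i ≤ t1 then P1 i else P2 (i - t1), ⟨?_, ?_, ?_, ?_⟩, ?_, by omega⟩
  · rw [hle 0 (by omega), a0]
  · rw [hge _ (by omega), Nat.add_sub_cancel_left, b1]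
  · intro z hz
    refine ⟨t1, by omega, ?_⟩
    rw [hle t1 le_rfl, a1]
    exact q1 hz
  · intro i hi
    rcases Nat.lt_or_ge i t1 with h | h
    · rw [hle i h.le, hle (i + 1) h]; exact a2 i h
    · rw [hge i h, hge (i + 1) (by omega), show i + 1 - t1 = i - t1 + 1 by omega]
      exact b2 _ (by omega)
  · refine Finset.sup_le fun i hi => ?_
    have hi' : i < t1 + t2 + 1 := Finset.mem_range.1 hi
    rcases le_total i t1 with h | h
    · rw [hle i h]; exact a3 i h
    · rw [hge i h]; exact b3 _ (by omega)

/-! ### Pyramids -/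

/-- The pyramid as a graph. -/
def PyrGraph (h : ℕ) : FinDigraph := { V := PyrV h, Edge := pyrEdge h }

theorem PyrV.ext' {h : ℕ} {p q : PyrV h} (h1 : p.1.1 = q.1.1) (h2 : p.2.1 = q.2.1) : p = q := by
  obtain ⟨⟨i, hi⟩, ⟨j, hj⟩⟩ := p
  obtain ⟨⟨i', hi'⟩, ⟨j', hj'⟩⟩ := q
  simp only at h1 h2
  subst h1
  subst h2
  rfl

/-- The frontier while row `i` is being filled and its first `j` vertices are done. -/
def pyrCut (h i j : ℕ) : Set (PyrGraph h).V :=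
  {p : PyrV h | (p.1.1 = i ∧ p.2.1 < j) ∨ (p.1.1 + 1 = i ∧ j ≤ p.2.1)}

theorem pyrCut_ncard (h i j : ℕ) : (pyrCut h i j).ncard ≤ h + 1 := by
  have : (pyrCut h i j).ncard ≤ (Set.Iio (h + 1)).ncard := by
    refine Set.ncard_le_ncard_of_injOn (fun p : PyrV h => p.2.1) ?_ ?_ (Set.toFinite _)
    · intro p _
      have := p.2.2
      simp only [Set.mem_Iio]
      omega
    · intro p hp q hq hpq
      simp only at hpq
      refine PyrV.ext' ?_ hpq
      rcases hp with hp | hp <;> rcases hq with hq | hq <;> omega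
  simpa [Set.ncard_eq_toFinset_card'] using this

theorem pyr_run (h : ℕ) :
    CSRun (PyrGraph h) (h + 2) (Fintype.card (PyrV h)) ∅ {pyrSink h} := by
  have hrow : ∀ i < h + 1,
      CSRun (PyrGraph h) (h + 2) (h + 1 - i) (pyrCut h i 0) (pyrCut h (i + 1) 0) := by
    intro i hi
    have := CSRun.iterate (G := PyrGraph h) (s := h + 2) (fun j => pyrCut h i j) (fun _ => 1)
      ((pyrCut_ncard h i 0).trans (by omega)) (h + 1 - i) (by
        intro j hj
        refine CSRun.place (⟨⟨i, hi⟩, ⟨j, hj⟩⟩ : PyrV h) ?_ ?_ ?_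
        · rintro p hp
          obtain ⟨h1, h2⟩ : pyrEdge h p ⟨⟨i, hi⟩, ⟨j, hj⟩⟩ := hp
          simp only at h1 h2
          right
          constructor <;> omega
        · intro p hp
          by_cases hpe : p.1.1 = i ∧ p.2.1 = j
          · left; exact PyrV.ext' hpe.1 hpe.2
          · right
            rcases hp with hp | hp
            · left; constructor <;> omega
            · right; constructor <;> omega
        · exact (Set.ncard_insert_le _ _).trans (by have := pyrCut_ncard h i j; omega))
    simp only [Finset.sum_const, Finset.card_range, smul_eq_mul, mul_one] at this
    refine this.drop ?_
    intro p hp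
    left
    have := p.2.2
    rcases hp with hp | hp
    · omega
    · have h1 : p.1.1 = i := by omega
      constructor <;> omega
  have := CSRun.iterate (G := PyrGraph h) (s := h + 2) (fun i => pyrCut h i 0)
    (fun i => h + 1 - i) ((pyrCut_ncard h 0 0).trans (by omega)) (h + 1) hrow
  have e0 : pyrCut h 0 0 = ∅ := by
    refine Set.eq_empty_of_forall_notMem fun p hp => ?_
    rcases hp with hp | hp <;> omega
  have ec : Fintype.card (PyrV h) = ∑ i ∈ Finset.range (h + 1), (h + 1 - i) := by
    have : Fintype.card (PyrV h) = Fintype.card (Σ i : Fin (h + 1), Fin (h + 1 - i.1)) :=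
      Fintype.card_congr (Equiv.refl _)
    rw [this, Fintype.card_sigma]
    simp only [Fintype.card_fin]
    exact Fin.sum_univ_eq_sum_range (fun i => h + 1 - i) (h + 1)
  rw [ec]
  rw [e0] at this
  refine this.drop ?_
  rintro p rfl
  right
  simp [pyrSink]

theorem card_pyr_le (h : ℕ) : Fintype.card (PyrV h) ≤ (h + 1) * (h + 1) := by
  have : Fintype.card (PyrV h) = Fintype.card (Σ i : Fin (h + 1), Fin (h + 1 - i.1)) :=
    Fintype.card_congr (Equiv.refl _)
  rw [this, Fintype.card_sigma]
  simp only [Fintype.card_fin]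
  refine (Finset.sum_le_card_nsmul _ _ (h + 1) (fun i _ => by omega)).trans ?_
  simp

/-! ### Carlson–Savage graphs -/

/-- Pyramid vertices. -/
def csP (c r : ℕ) (i : Fin c) (p : (PyrGraph (r + 1)).V) : (CSGraph c (r + 1)).V :=
  (Sum.inl (i, p) : (Fin c × PyrV (r + 1)) ⊕ CSV c r ⊕ (Fin c × Fin ((r + 1) * (2 * c))))

/-- Inner vertices. -/
def csI (c r : ℕ) (v : (CSGraph c r).V) : (CSGraph c (r + 1)).V :=
  (Sum.inr (Sum.inl v) : (Fin c × PyrV (r + 1)) ⊕ CSV c r ⊕ (Fin c × Fin ((r + 1) * (2 * c))))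

/-- Spine vertices. -/
def csS (c r : ℕ) (i : Fin c) (k : Fin ((r + 1) * (2 * c))) : (CSGraph c (r + 1)).V :=
  (Sum.inr (Sum.inr (i, k)) :
    (Fin c × PyrV (r + 1)) ⊕ CSV c r ⊕ (Fin c × Fin ((r + 1) * (2 * c))))

theorem pred_csP (c r : ℕ) (i : Fin c) (q : (PyrGraph (r + 1)).V) :
    (CSGraph c (r + 1)).pred (csP c r i q) ⊆ csP c r i '' ((PyrGraph (r + 1)).pred q) := by
  intro a ha
  have ha' : CSEdge c (r + 1) a (csP c r i q) := ha
  simp only [CSEdge, csP] at ha'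
  rcases ha' with ⟨i', p, q', h, rfl, h2⟩ | ⟨_, _, _, _, h2⟩ | ⟨_, _, _, _, _, h2⟩ |
    ⟨_, _, _, _, _, h2⟩ | ⟨_, _, _, _, _, h2⟩
  · injection h2 with h2
    injection h2 with h2 h3
    subst h2 h3
    exact ⟨p, h, rfl⟩
  all_goals cases h2

theorem pred_csI (c r : ℕ) (v : (CSGraph c r).V) :
    (CSGraph c (r + 1)).pred (csI c r v) ⊆ csI c r '' ((CSGraph c r).pred v) := by
  intro a ha
  have ha' : CSEdge c (r + 1) a (csI c r v) := ha
  simp only [CSEdge, csI] at ha'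
  rcases ha' with ⟨_, _, _, _, _, h2⟩ | ⟨u, w, h, rfl, h2⟩ | ⟨_, _, _, _, _, h2⟩ |
    ⟨_, _, _, _, _, h2⟩ | ⟨_, _, _, _, _, h2⟩
  · cases h2
  · injection h2 with h2
    injection h2 with h2
    subst h2
    exact ⟨u, h, rfl⟩
  all_goals (injection h2 with h2; cases h2)

/-- The sinks of the pyramids and of the inner graph. -/
def csBase (c r : ℕ) : Set (CSGraph c (r + 1)).V :=
  (csI c r '' Set.range (CSsink c r)) ∪ Set.range (fun j => csP c r j (pyrSink (r + 1)))

theorem pred_csS (c r : ℕ) (i : Fin c) (k : Fin ((r + 1) * (2 * c))) :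
    (CSGraph c (r + 1)).pred (csS c r i k) ⊆
      {a | ∃ k' : Fin ((r + 1) * (2 * c)), k.1 = k'.1 + 1 ∧ a = csS c r i k'} ∪ csBase c r := by
  intro a ha
  have ha' : CSEdge c (r + 1) a (csS c r i k) := ha
  simp only [CSEdge, csS] at ha'
  rcases ha' with ⟨_, _, _, _, _, h2⟩ | ⟨_, _, _, _, h2⟩ | ⟨i', k1, k2, h, rfl, h2⟩ |
    ⟨j, _, _, _, rfl, h2⟩ | ⟨j, _, _, _, rfl, h2⟩
  · cases h2
  · injection h2 with h2; cases h2
  · injection h2 with h2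
    injection h2 with h2
    injection h2 with h2 h3
    subst h2 h3
    exact Or.inl ⟨k1, h, rfl⟩
  · exact Or.inr (Or.inr ⟨j, rfl⟩)
  · exact Or.inr (Or.inl ⟨_, ⟨j, rfl⟩, rfl⟩)

theorem range_ncard_le {α : Type} {c : ℕ} (f : Fin c → α) : (Set.range f).ncard ≤ c := by
  rw [← Set.image_univ]
  refine (Set.ncard_image_le (Set.toFinite _)).trans ?_
  simp [Set.ncard_univ]

theorem sub_range_ncard_le {α : Type} {c : ℕ} (f : Fin c → α) (j : ℕ) :
    (f '' {i | i.1 < j}).ncard ≤ c :=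
  (Set.ncard_le_ncard (Set.image_subset_range _ _) (Set.finite_range f)).trans (range_ncard_le f)

theorem sub_range_succ {α : Type} {c : ℕ} (f : Fin c → α) (j : ℕ) (hj : j < c) :
    f '' {i | i.1 < j + 1} = insert (f ⟨j, hj⟩) (f '' {i | i.1 < j}) := by
  rw [← Set.image_insert_eq]
  congr 1
  ext i
  simp only [Set.mem_ofPred_eq, Set.mem_insert_iff, Fin.ext_iff]
  omega

theorem sub_range_full {α : Type} {c : ℕ} (f : Fin c → α) :
    f '' {i | i.1 < c} = Set.range f := by
  rw [← Set.image_univ]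
  congr 1
  ext i
  simp

theorem sub_range_zero {α : Type} {c : ℕ} (f : Fin c → α) :
    f '' {i | i.1 < 0} = ∅ := by simp

theorem card_CSV_zero (c : ℕ) : Fintype.card (CSV c 0) = 2 + c := by
  have : Fintype.card (CSV c 0) = Fintype.card (Fin 2 ⊕ Fin c) :=
    Fintype.card_congr (Equiv.refl _)
  rw [this]
  simp

theorem card_CSV_succ (c r : ℕ) : Fintype.card (CSV c (r + 1)) =
    Fintype.card (CSV c r) + c * Fintype.card (PyrV (r + 1)) + c * ((r + 1) * (2 * c)) := by
  have : Fintype.card (CSV c (r + 1)) =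
      Fintype.card ((Fin c × PyrV (r + 1)) ⊕ CSV c r ⊕ (Fin c × Fin ((r + 1) * (2 * c)))) :=
    Fintype.card_congr (Equiv.refl _)
  rw [this]
  simp only [Fintype.card_sum, Fintype.card_prod, Fintype.card_fin]
  ring

theorem card_CSV_le (c r : ℕ) (hc : 2 ≤ c) : Fintype.card (CSV c r) ≤ 4 * c ^ 2 * (r + 1) ^ 3 := by
  induction r with
  | zero => rw [card_CSV_zero]; nlinarith
  | succ r ih =>
    rw [card_CSV_succ]
    have h1 := card_pyr_le (r + 1)
    have h2 : c * Fintype.card (PyrV (r + 1)) ≤ c * ((r + 1 + 1) * (r + 1 + 1)) :=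
      Nat.mul_le_mul_left _ h1
    have h3 : c * ((r + 1 + 1) * (r + 1 + 1)) ≤ c ^ 2 * ((r + 1 + 1) * (r + 1 + 1)) :=
      Nat.mul_le_mul_right _ (by nlinarith)
    have h4 : c ^ 2 * ((r + 1 + 1) * (r + 1 + 1)) + c * ((r + 1) * (2 * c)) +
        4 * c ^ 2 * (r + 1) ^ 3 ≤ 4 * c ^ 2 * (r + 1 + 1) ^ 3 := by
      have : c ^ 2 * ((r + 1 + 1) * (r + 1 + 1)) + c * ((r + 1) * (2 * c)) +
        4 * c ^ 2 * (r + 1) ^ 3 = c ^ 2 * ((r + 1 + 1) * (r + 1 + 1) + 2 * (r + 1) +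
        4 * (r + 1) ^ 3) := by ring
      rw [this, show 4 * c ^ 2 * (r + 1 + 1) ^ 3 = c ^ 2 * (4 * (r + 1 + 1) ^ 3) by ring]
      refine Nat.mul_le_mul_left _ ?_
      ring_nf
      nlinarith [sq_nonneg r]
    omega

theorem card_CSV_ge (c r : ℕ) : c + 2 ≤ Fintype.card (CSV c r) := by
  induction r with
  | zero => rw [card_CSV_zero]; omega
  | succ r ih => rw [card_CSV_succ]; omega

theorem cs_run_zero (c : ℕ) :
    CSRun (CSGraph c 0) (c + 3) (Fintype.card (CSV c 0)) ∅ (Set.range (CSsink c 0)) := by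
  let src : Fin 2 → (CSGraph c 0).V := fun i => (Sum.inl i : Fin 2 ⊕ Fin c)
  let snk : Fin c → (CSGraph c 0).V := CSsink c 0
  have psrc : ∀ i, (CSGraph c 0).pred (src i) = ∅ := by
    intro i
    ext a
    simp only [Set.mem_empty_iff_false, iff_false]
    rintro ⟨_, _, _, h⟩
    cases h
  have psnk : ∀ i, (CSGraph c 0).pred (snk i) ⊆ Set.range src := by
    rintro i a ⟨i', _, rfl, _⟩
    exact ⟨i', rfl⟩
  have r1 := CSRun.iterate (G := CSGraph c 0) (s := c + 3) (fun j => src '' {i | i.1 < j})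
    (fun _ => 1) ((sub_range_ncard_le src 0).trans (by omega)) 2 (by
      intro j hj
      have h2 := sub_range_ncard_le src (j + 1)
      refine CSRun.place (src ⟨j, hj⟩) (by rw [psrc]; simp) ?_ ?_ <;>
        rw [← sub_range_succ src j hj]
      omega)
  have hb : ∀ j, (Set.range src ∪ snk '' {i | i.1 < j}).ncard ≤ c + 3 := by
    intro j
    refine (Set.ncard_union_le _ _).trans ?_
    have h1 := range_ncard_le src
    have h2 := sub_range_ncard_le snk j
    omega
  have r2 := CSRun.iterate (G := CSGraph c 0) (s := c + 3)
    (fun j => Set.range src ∪ snk '' {i | i.1 < j}) (fun _ => 1) (hb 0) c (by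
      intro j hj
      have h2 := hb (j + 1)
      refine CSRun.place (snk ⟨j, hj⟩) ((psnk _).trans Set.subset_union_left) ?_ ?_ <;>
        rw [← Set.union_insert, ← sub_range_succ snk j hj]
      exact h2)
  simp only [sub_range_full, sub_range_zero, Set.union_empty, Finset.sum_const, Finset.card_range,
    smul_eq_mul, mul_one] at r1 r2
  rw [card_CSV_zero]
  exact (r1.trans r2).drop Set.subset_union_right

theorem cs_run_succ (c r s : ℕ) (hs : 3 * c + r + 4 ≤ s)
    (ih : CSRun (CSGraph c r) s (Fintype.card (CSV c r)) ∅ (Set.range (CSsink c r))) :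
    CSRun (CSGraph c (r + 1)) s (Fintype.card (CSV c (r + 1))) ∅
      (Set.range (CSsink c (r + 1))) := by
  have r1 := ih.map (csI c r) (pred_csI c r)
  rw [Set.image_empty] at r1
  let I : Set (CSGraph c (r + 1)).V := csI c r '' Set.range (CSsink c r)
  have hI : I.ncard ≤ c := (Set.ncard_image_le (Set.toFinite _)).trans (range_ncard_le _)
  let ps : Fin c → (CSGraph c (r + 1)).V := fun j => csP c r j (pyrSink (r + 1))
  have hIp : ∀ j, (I ∪ ps '' {i | i.1 < j}).ncard ≤ 2 * c := by
    intro j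
    refine (Set.ncard_union_le _ _).trans ?_
    have := sub_range_ncard_le ps j
    omega
  have r2 := CSRun.iterate (G := CSGraph c (r + 1)) (s := s)
    (fun j => I ∪ ps '' {i | i.1 < j}) (fun _ => Fintype.card (PyrV (r + 1)))
    ((hIp 0).trans (by omega)) c (by
      intro j hj
      have h1 := ((pyr_run (r + 1)).map (csP c r ⟨j, hj⟩) (pred_csP c r ⟨j, hj⟩)).frame
        (I ∪ ps '' {i | i.1 < j})
      rw [Set.image_empty, Set.empty_union] at h1
      have h2 := hIp j
      refine (h1.mono (by omega)).drop ?_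
      simp only [sub_range_succ ps j hj]
      rw [Set.union_insert]
      exact Set.insert_subset (Or.inl ⟨pyrSink (r + 1), rfl, rfl⟩) Set.subset_union_right)
  have hB : (csBase c r).ncard ≤ 2 * c := by
    have := hIp c
    rwa [sub_range_full] at this
  let L := (r + 1) * (2 * c)
  let snk : Fin c → (CSGraph c (r + 1)).V := CSsink c (r + 1)
  have hBs : ∀ j, (csBase c r ∪ snk '' {i | i.1 < j}).ncard ≤ 3 * c := by
    intro j
    refine (Set.ncard_union_le _ _).trans ?_
    have := sub_range_ncard_le snk j
    omega
  have r3 := CSRun.iterate (G := CSGraph c (r + 1)) (s := s)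
    (fun j => csBase c r ∪ snk '' {i | i.1 < j}) (fun _ => L)
    ((hBs 0).trans (by omega)) c (by
      intro j hj
      let F := csBase c r ∪ snk '' {i | i.1 < j}
      have hF : F.ncard ≤ 3 * c := hBs j
      let cur : ℕ → Set (CSGraph c (r + 1)).V := fun k =>
        {a | ∃ k' : Fin ((r + 1) * (2 * c)), k = k'.1 + 1 ∧ a = csS c r ⟨j, hj⟩ k'}
      have hcur : ∀ k, (cur k).ncard ≤ 1 := by
        intro k
        rw [Set.ncard_le_one_iff]
        rintro a b ⟨k1, h1, rfl⟩ ⟨k2, h2, rfl⟩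
        have : k1 = k2 := Fin.ext (by omega)
        rw [this]
      have hc : ∀ k, (F ∪ cur k).ncard ≤ 3 * c + 1 := by
        intro k
        refine (Set.ncard_union_le _ _).trans ?_
        have := hcur k
        omega
      have h1 := CSRun.iterate (G := CSGraph c (r + 1)) (s := s)
        (fun k => F ∪ cur k) (fun _ => 1) ((hc 0).trans (by omega)) L (by
          intro k hk
          refine CSRun.place (csS c r ⟨j, hj⟩ ⟨k, hk⟩) ?_ ?_ ?_
          · refine (pred_csS c r ⟨j, hj⟩ ⟨k, hk⟩).trans ?_
            rw [Set.union_comm]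
            exact Set.union_subset_union_left _ Set.subset_union_left
          · rintro a (ha | ⟨k', hk', rfl⟩)
            · exact Or.inr (Or.inl ha)
            · left
              have : k' = ⟨k, hk⟩ := Fin.ext (by simp only; omega)
              rw [this]
          · exact (Set.ncard_insert_le _ _).trans (by have := hc k; omega))
      have e0 : cur 0 = ∅ := by
        ext a
        simp [cur]
      simp only [e0, Set.union_empty, Finset.sum_const, Finset.card_range,
        smul_eq_mul, mul_one] at h1
      refine h1.drop ?_
      simp only [sub_range_succ snk j hj]
      rw [Set.union_insert]
      refine Set.insert_subset (Or.inr ?_) Set.subset_union_left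
      have hL : 0 < L := Nat.mul_pos (Nat.succ_pos r) (by omega)
      exact ⟨⟨L - 1, by omega⟩, by simp only; omega, rfl⟩)
  simp only [sub_range_full, sub_range_zero, Set.union_empty, Finset.sum_const, Finset.card_range,
    smul_eq_mul] at r2 r3
  rw [card_CSV_succ]
  exact ((r1.trans r2).trans r3).drop Set.subset_union_right

theorem cs_run (c r : ℕ) : CSRun (CSGraph c r) (3 * c + r + 3) (Fintype.card (CSV c r)) ∅
    (Set.range (CSsink c r)) := by
  induction r with
  | zero => exact (cs_run_zero c).mono (by omega)
  | succ r ih => exact cs_run_succ c r _ (by omega) (ih.mono (by omega))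

/-! ### Parameters -/

theorem bennett_params (N : ℕ) (hN : 2 ≤ N) (ε : ℝ) (he0 : 0 < ε) (he1 : ε ≤ 1) :
    ∃ m k : ℕ, N ≤ k ^ m ∧ 1 ≤ m * k ∧
      ((m * k : ℕ) : ℝ) ≤ 4 * (ε * (2 : ℝ) ^ ((1 : ℝ) / ε)) * Real.logb 2 N ∧
      (2 : ℝ) ^ m ≤ 2 * (N : ℝ) ^ ε := by
  have hN2 : (2 : ℝ) ≤ N := by exact_mod_cast hN
  have hNpos : (0 : ℝ) < N := by linarith
  obtain ⟨y, hy⟩ : ∃ y, y = Real.logb 2 N := ⟨_, rfl⟩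
  have hNy : (2 : ℝ) ^ y = N := by
    rw [hy]; exact Real.rpow_logb (by norm_num) (by norm_num) hNpos
  have hy1 : 1 ≤ y := by
    rw [hy, Real.le_logb_iff_rpow_le (by norm_num) hNpos]; simpa using hN2
  obtain ⟨x, hx⟩ : ∃ x, x = 1 / ε := ⟨_, rfl⟩
  have hex : ε * x = 1 := by rw [hx]; field_simp
  have hx1 : 1 ≤ x := by rw [hx, le_div_iff₀ he0]; linarith
  rw [← hy, ← hx]
  have h2x : (2 : ℝ) ≤ 2 ^ x := by
    simpa using Real.rpow_le_rpow_of_exponent_le (by norm_num : (1 : ℝ) ≤ 2) hx1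
  rcases le_or_gt 1 (ε * y) with h | h
  · have hk1 : (2 : ℝ) ^ x ≤ (⌈(2 : ℝ) ^ x⌉₊ : ℝ) := Nat.le_ceil _
    have hk2 : (⌈(2 : ℝ) ^ x⌉₊ : ℝ) < 2 ^ x + 1 := Nat.ceil_lt_add_one (by positivity)
    have hm1 : ε * y ≤ (⌈ε * y⌉₊ : ℝ) := Nat.le_ceil _
    have hm2 : (⌈ε * y⌉₊ : ℝ) < ε * y + 1 := Nat.ceil_lt_add_one (by positivity)
    generalize ⌈(2 : ℝ) ^ x⌉₊ = k at *
    generalize ⌈ε * y⌉₊ = m at *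
    refine ⟨m, k, ?_, ?_, ?_, ?_⟩
    · have : (N : ℝ) ≤ (k : ℝ) ^ m := by
        calc (N : ℝ) = 2 ^ y := hNy.symm
          _ ≤ 2 ^ (x * m) := by
            refine Real.rpow_le_rpow_of_exponent_le (by norm_num) ?_
            have : x * (ε * y) ≤ x * m := mul_le_mul_of_nonneg_left hm1 (by linarith)
            have e : x * (ε * y) = y := by rw [← mul_assoc, mul_comm x, hex, one_mul]
            linarith
          _ = ((2 : ℝ) ^ x) ^ m := by rw [Real.rpow_mul (by norm_num), Real.rpow_natCast]
          _ ≤ (k : ℝ) ^ m := by gcongr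
      exact_mod_cast this
    · have h1 : (0 : ℝ) < m := by linarith
      have h2 : (0 : ℝ) < k := by linarith
      exact Nat.mul_pos (by exact_mod_cast h1) (by exact_mod_cast h2)
    · push_cast
      calc (m : ℝ) * k ≤ (2 * (ε * y)) * (2 * 2 ^ x) :=
            mul_le_mul (by linarith) (by linarith) (by positivity) (by positivity)
        _ = _ := by ring
    · calc (2 : ℝ) ^ m = (2 : ℝ) ^ (m : ℝ) := (Real.rpow_natCast _ _).symm
        _ ≤ 2 ^ (y * ε + 1) := Real.rpow_le_rpow_of_exponent_le (by norm_num) (by linarith)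
        _ = 2 * (N : ℝ) ^ ε := by
          rw [Real.rpow_add (by norm_num), Real.rpow_mul (by norm_num), hNy, Real.rpow_one, mul_comm]
  · refine ⟨1, N, by simp, by omega, ?_, ?_⟩
    · have hs : y < x := by
        have : ε * y < ε * x := by linarith
        exact lt_of_mul_lt_mul_left this he0.le
      have hb : 1 + (x - y) / 2 ≤ (2 : ℝ) ^ (x - y) := by
        rw [Real.rpow_def_of_pos (by norm_num)]
        have := Real.add_one_le_exp (Real.log 2 * (x - y))
        have hl := Real.log_two_gt_d9
        nlinarith
      have e : (2 : ℝ) ^ x = N * 2 ^ (x - y) := by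
        rw [← hNy, ← Real.rpow_add (by norm_num)]; congr 1; ring
      have h1 : 1 ≤ 4 * ε * y * 2 ^ (x - y) := by
        have h2 : x ≤ 4 * y * 2 ^ (x - y) := by
          have : 4 * y * (1 + (x - y) / 2) ≤ 4 * y * 2 ^ (x - y) :=
            mul_le_mul_of_nonneg_left hb (by linarith)
          nlinarith
        calc 1 = ε * x := hex.symm
          _ ≤ ε * (4 * y * 2 ^ (x - y)) := mul_le_mul_of_nonneg_left h2 he0.le
          _ = _ := by ring
      rw [e]
      push_cast
      nlinarith
    · have : (1 : ℝ) ≤ (N : ℝ) ^ ε := Real.one_le_rpow (by linarith) he0.le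
      simpa using this

theorem log_card_le (c q : ℕ) (hc : 2 ≤ c) :
    Real.logb 2 (Fintype.card (CSV c q)) ≤ 5 * Real.logb 2 ((c : ℝ) * ((q + 1 : ℕ) : ℝ)) := by
  have h0 : 0 < Fintype.card (CSV c q) := by have := card_CSV_ge c q; omega
  have hx : 2 ≤ c * (q + 1) := by nlinarith
  have h1 : Fintype.card (CSV c q) ≤ (c * (q + 1)) ^ 5 := by
    calc Fintype.card (CSV c q) ≤ 4 * c ^ 2 * (q + 1) ^ 3 := card_CSV_le c q hc
      _ ≤ 4 * c ^ 3 * (q + 1) ^ 3 := by gcongr <;> omega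
      _ = 2 ^ 2 * (c * (q + 1)) ^ 3 := by ring
      _ ≤ (c * (q + 1)) ^ 2 * (c * (q + 1)) ^ 3 := by gcongr
      _ = _ := by ring
  calc Real.logb 2 (Fintype.card (CSV c q)) ≤ Real.logb 2 (((c : ℝ) * ((q + 1 : ℕ) : ℝ)) ^ 5) := by
        refine Real.logb_le_logb_of_le (by norm_num) (by exact_mod_cast h0) ?_
        exact_mod_cast h1
    _ = _ := by rw [Real.logb_pow]; norm_num

/-- There is an absolute constant `C` such that for every `0 < ε ≤ 1` and all
`c ≥ 2`, `r ≥ 1`, the Carlson–Savage graph `Γ(c, r)` (here `CSGraph c (r - 1)`, with `n` its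
number of vertices) has a reversible pebbling, placing a pebble on every sink at some point,
with space at most `C * ε * 2^{1/ε} * (c + r) * log₂(c * r)` and time at most `C * n^{1+ε}`. -/
theorem carlson_savage_time_space_tradeoff :
    ∃ C : ℝ, 0 < C ∧ ∀ ε : ℝ, 0 < ε → ε ≤ 1 → ∀ c r : ℕ, 2 ≤ c → 1 ≤ r →
      ∃ (t : ℕ) (P : ℕ → Set (CSGraph c (r - 1)).V),
        (CSGraph c (r - 1)).IsRevPebblingMulti (Set.range (CSsink c (r - 1))) t P ∧
        ((CSGraph c (r - 1)).space t P : ℝ) ≤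
          C * ε * (2 : ℝ) ^ ((1 : ℝ) / ε) * ((c : ℝ) + r) * Real.logb 2 (c * r) ∧
        (t : ℝ) ≤ C * (Fintype.card (CSV c (r - 1)) : ℝ) ^ ((1 : ℝ) + ε) := by
  refine ⟨300, by norm_num, ?_⟩
  intro ε he0 he1 c r hc hr
  obtain ⟨q, rfl⟩ : ∃ q, r = q + 1 := ⟨r - 1, by omega⟩
  simp only [Nat.add_sub_cancel]
  have hN2 : 2 ≤ Fintype.card (CSV c q) := by have := card_CSV_ge c q; omega
  obtain ⟨m, k, hT, hmk1, hmk, h2m⟩ := bennett_params (Fintype.card (CSV c q)) hN2 ε he0 he1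
  obtain ⟨t, P, hP, hsp, ht⟩ := rev_of_run (cs_run c q) k m hT
  refine ⟨t, P, hP, ?_, ?_⟩
  · have hlog := log_card_le c q hc
    have h1 : (CSGraph c q).space t P ≤ (m * k) * (15 * (c + (q + 1))) := by
      calc (CSGraph c q).space t P ≤ (m * k + 2) * (3 * c + q + 3) := hsp
        _ ≤ (3 * (m * k)) * (5 * (c + (q + 1))) := Nat.mul_le_mul (by omega) (by omega)
        _ = _ := by ring
    have h2 : ((CSGraph c q).space t P : ℝ) ≤ ((m * k : ℕ) : ℝ) * (15 * ((c : ℝ) + (q + 1))) := by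
      exact_mod_cast h1
    push_cast at hlog ⊢
    have hpos : 0 < ε * (2 : ℝ) ^ ((1 : ℝ) / ε) := by positivity
    calc ((CSGraph c q).space t P : ℝ) ≤ ((m * k : ℕ) : ℝ) * (15 * ((c : ℝ) + (q + 1))) := h2
      _ ≤ (4 * (ε * (2 : ℝ) ^ ((1 : ℝ) / ε)) * (5 * Real.logb 2 (c * (q + 1)))) *
          (15 * ((c : ℝ) + (q + 1))) := by
        refine mul_le_mul_of_nonneg_right (hmk.trans ?_) (by positivity)
        exact mul_le_mul_of_nonneg_left hlog (by positivity)
      _ = _ := by ring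
  · have hNpos : (0 : ℝ) < (Fintype.card (CSV c q) : ℝ) := by exact_mod_cast (by omega)
    have h1 : (t : ℝ) ≤ 2 * ((2 : ℝ) ^ m * (Fintype.card (CSV c q) : ℝ)) := by exact_mod_cast ht
    rw [Real.rpow_add hNpos, Real.rpow_one]
    have h3 : (2 : ℝ) ^ m * (Fintype.card (CSV c q) : ℝ) ≤
        (2 * (Fintype.card (CSV c q) : ℝ) ^ ε) * (Fintype.card (CSV c q) : ℝ) :=
      mul_le_mul_of_nonneg_right h2m hNpos.le
    have h4 : 0 ≤ (Fintype.card (CSV c q) : ℝ) * (Fintype.card (CSV c q) : ℝ) ^ ε := by positivity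
    nlinarith
end

section
/- There is a family {G_n} of DAGs, each with a unique sink and maximum in-degree 2, where G_n has Θ(n) vertices, such that: (1) the reversible pebbling price of G_n is O(n^{1/6}·log n); (2) for every constant ε > 0 there is a reversible pebbling of G_n with time O(n^{1+ε}) and space O(n^{1/3}·log n); and (3) there is a constant K > 0 such that every standard pebbling of G_n with space at most K·n^{1/3} has time at least ⌊n^{1/6}⌋!. -/
open MvPolynomial

namespace RevPeb

/-- `Walk M n a b`: from `a` one can reach `b` in at most `n` steps of `M`. -/
inductive Walk {α : Type} (M : α → α → Prop) : ℕ → α → α → Prop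
  | refl (n : ℕ) (a : α) : Walk M n a a
  | step {n : ℕ} {a b c : α} : M a b → Walk M n b c → Walk M (n + 1) a c

namespace Walk

variable {α β : Type} {M : α → α → Prop} {M' : β → β → Prop}

theorem mono {n m : ℕ} {a b : α} (h : Walk M n a b) (hm : n ≤ m) : Walk M m a b := by
  induction h generalizing m with
  | refl n a => exact .refl _ _
  | step h1 _ ih =>
    obtain ⟨m', rfl⟩ : ∃ m', m = m' + 1 := ⟨m - 1, by omega⟩
    exact .step h1 (ih (by omega))

theorem trans {n m : ℕ} {a b c : α} (h : Walk M n a b) (h' : Walk M m b c) :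
    Walk M (n + m) a c := by
  induction h with
  | refl n a => exact h'.mono (by omega)
  | step h1 _ ih => exact (Walk.step h1 (ih h')).mono (by omega)

theorem single {a b : α} (h : M a b) : Walk M 1 a b := .step h (.refl 0 _)

theorem symm (hM : ∀ a b, M a b → M b a) {n : ℕ} {a b : α} (h : Walk M n a b) :
    Walk M n b a := by
  induction h with
  | refl n a => exact .refl _ _
  | step h1 _ ih => exact ih.trans (single (hM _ _ h1))

theorem lift (f : α → β) (t : ℕ) (hf : ∀ a b, M a b → Walk M' t (f a) (f b))
    {n : ℕ} {a b : α} (h : Walk M n a b) : Walk M' (n * t) (f a) (f b) := by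
  induction h with
  | refl n a => exact .refl _ _
  | step h1 _ ih => exact ((hf _ _ h1).trans ih).mono (by rw [Nat.add_mul]; omega)

theorem toSeq {n : ℕ} {a b : α} (h : Walk M n a b) :
    ∃ k ≤ n, ∃ P : ℕ → α, P 0 = a ∧ P k = b ∧ ∀ i < k, M (P i) (P (i + 1)) := by
  induction h with
  | refl n a => exact ⟨0, by omega, fun _ => a, rfl, rfl, by simp⟩
  | @step n a b c h1 _ ih =>
    obtain ⟨k, hk, P, h0, hk', hs⟩ := ih
    refine ⟨k + 1, by omega, fun i => Nat.casesOn i a P, rfl, hk', ?_⟩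
    rintro (_ | i) hi
    · simpa [h0] using h1
    · exact hs i (by omega)

end Walk

/-! ### Reversible pebbling of a line -/

/-- A move of the line game: position `0` is always available; position `q+1` may be toggled
if `q` is present. -/
def LM (N cap : ℕ) (s s' : Finset ℕ) : Prop :=
  (∃ q < N, q ∈ s ∧ ((q + 1 ∉ s ∧ s' = insert (q + 1) s) ∨ (q + 1 ∈ s ∧ s' = s.erase (q + 1)))) ∧
    s.card ≤ cap ∧ s'.card ≤ cap

theorem LM.symm (N cap : ℕ) (s s' : Finset ℕ) (h : LM N cap s s') : LM N cap s' s := by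
  obtain ⟨⟨q, hq, hqs, h⟩, h1, h2⟩ := h
  refine ⟨⟨q, hq, ?_⟩, h2, h1⟩
  rcases h with ⟨h, rfl⟩ | ⟨h, rfl⟩
  · refine ⟨by simp [hqs], Or.inr ⟨by simp, by simp [h]⟩⟩
  · refine ⟨by simp [hqs], Or.inl ⟨by simp, by simp [h]⟩⟩

/-- Segments of length at most `d` can be pebbled in time `T` and extra space `S`. -/
def Seg (N cap T S d : ℕ) : Prop :=
  ∀ (b L : ℕ) (s : Finset ℕ), 1 ≤ L → L ≤ d → b ∈ s → (∀ x ∈ s, x ≤ b ∨ b + L < x) →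
    b + L ≤ N → s.card + S ≤ cap → Walk (LM N cap) T s (insert (b + L) s)

theorem seg_one (N cap : ℕ) : Seg N cap 1 1 1 := by
  intro b L s h1 h2 hb hs hN hc
  obtain rfl : L = 1 := by omega
  have : b + 1 ∉ s := fun h => by have := hs _ h; omega
  refine Walk.single ⟨⟨b, by omega, hb, Or.inl ⟨this, rfl⟩⟩, by omega, ?_⟩
  rw [Finset.card_insert_of_notMem this]; exact hc

theorem seg_mul (N cap T S d : ℕ) (h : Seg N cap T S d) (hd : 1 ≤ d) (j : ℕ) :
    Seg N cap ((2 * j + 1) * T) (S + j) ((j + 1) * d) := by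
  induction j with
  | zero => simpa using h
  | succ j ih =>
    intro b L s h1 h2 hb hs hN hc
    have hbd : (j + 1 + 1) * d = (j + 1) * d + d := by ring
    by_cases hL : L ≤ d
    · refine (h b L s h1 hL hb hs hN (by omega)).mono ?_
      nlinarith
    · have w1 := h b d s hd le_rfl hb (fun x hx => by have := hs x hx; omega) (by omega) (by omega)
      have c1 := Finset.card_insert_le (b + d) s
      have w2 := ih (b + d) (L - d) (insert (b + d) s) (by omega) (by omega) (by simp)
        (fun x hx => by
          rcases Finset.mem_insert.1 hx with rfl | hx
          · left; omega
          · have := hs x hx; omega) (by omega) (by omega)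
      have e : b + d + (L - d) = b + L := by omega
      rw [e, Finset.insert_comm] at w2
      have c2 := Finset.card_insert_le (b + L) s
      have w3 := h b d (insert (b + L) s) hd le_rfl (by simp [hb])
        (fun x hx => by
          rcases Finset.mem_insert.1 hx with rfl | hx
          · right; omega
          · have := hs x hx; omega) (by omega) (by omega)
      refine ((w1.trans w2).trans (w3.symm (LM.symm N cap))).mono ?_
      apply le_of_eq; ring

theorem seg_pow (N cap j m : ℕ) : Seg N cap ((2 * j + 1) ^ m) (m * j + 1) ((j + 1) ^ m) := by
  induction m with
  | zero => simpa using seg_one N cap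
  | succ m ih =>
    have := seg_mul N cap _ _ _ ih (Nat.one_le_pow _ _ (by omega)) j
    rw [pow_succ', pow_succ']
    convert this using 1
    ring

theorem line (N j m : ℕ) (h1 : 1 ≤ N) (h2 : N ≤ (j + 1) ^ m) :
    Walk (LM N (m * j + 2)) ((2 * j + 1) ^ m) {0} {N, 0} := by
  have := seg_pow N (m * j + 2) j m 0 N {0} h1 h2 (by simp) (by simp) (by omega)
    (by simp; omega)
  simpa using this

/-! ### From walks to reversible pebblings -/

/-- Reversible moves between configurations with at most `cap` pebbles. -/
def CM (G : FinDigraph) (cap : ℕ) (P Q : Set G.V) : Prop :=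
  G.RevMove P Q ∧ P.ncard ≤ cap ∧ Q.ncard ≤ cap

theorem revMove_symm (G : FinDigraph) (hG : ∀ v, ¬ G.Edge v v) (P Q : Set G.V)
    (h : G.RevMove P Q) : G.RevMove Q P := by
  obtain ⟨v, hp, h⟩ := h
  have hv : ∀ u ∈ G.pred v, u ≠ v := by rintro u hu rfl; exact hG _ hu
  refine ⟨v, ?_⟩
  rcases h with ⟨h, rfl⟩ | ⟨h, rfl⟩
  · exact ⟨fun u hu => Or.inr (hp hu), Or.inr ⟨by simp, by simp [h]⟩⟩
  · exact ⟨fun u hu => ⟨hp hu, hv u hu⟩, Or.inl ⟨by simp, by simp [h]⟩⟩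

theorem CM.symm (G : FinDigraph) (hG : ∀ v, ¬ G.Edge v v) (cap : ℕ) (P Q : Set G.V)
    (h : CM G cap P Q) : CM G cap Q P :=
  ⟨revMove_symm G hG P Q h.1, h.2.2, h.2.1⟩

theorem toPebbling (G : FinDigraph) (hG : ∀ v, ¬ G.Edge v v) (z : G.V) (cap n : ℕ)
    (h : Walk (CM G cap) n ∅ {z}) :
    ∃ t P, G.IsRevPebbling z t P ∧ t ≤ 2 * n ∧ G.space t P ≤ cap := by
  obtain ⟨k, hk, Q, h0, hk', hs⟩ := h.toSeq
  have hk0 : k ≠ 0 := by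
    rintro rfl
    rw [h0] at hk'
    exact (Set.singleton_ne_empty z) hk'.symm
  have hcap : ∀ i ≤ k, (Q i).ncard ≤ cap := by
    intro i hi
    rcases Nat.lt_or_ge i k with h | h
    · exact (hs i h).2.1
    · have := (hs (i - 1) (by omega)).2.2
      rwa [show i - 1 + 1 = i by omega] at this
  refine ⟨2 * k, fun i => Q (min i (2 * k - i)), ⟨by simp [h0], by simp [h0], ⟨k, by omega, ?_⟩, ?_⟩,
    by omega, ?_⟩
  · have : min k (2 * k - k) = k := by omega
    simp [this, hk']
  · intro i hi
    rcases Nat.lt_or_ge i k with h | h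
    · have e1 : min i (2 * k - i) = i := by omega
      have e2 : min (i + 1) (2 * k - (i + 1)) = i + 1 := by omega
      simp only [e1, e2]
      exact (hs i h).1
    · have e1 : min i (2 * k - i) = (2 * k - (i + 1)) + 1 := by omega
      have e2 : min (i + 1) (2 * k - (i + 1)) = 2 * k - (i + 1) := by omega
      simp only [e1, e2]
      exact revMove_symm G hG _ _ (hs _ (by omega)).1
  · unfold FinDigraph.space
    refine Finset.sup_le fun i hi => hcap _ ?_
    omega

/-! ### The graph -/

/-- Vertices: level, spine index, position in the spine; the top level has one spine only. -/
abbrev Vt (r c : ℕ) : Type :=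
  {x : Fin (r + 1) × Fin c × Fin (r * c) // x.1.val = r → x.2.1.val = 0}

def lv {r c : ℕ} (v : Vt r c) : ℕ := v.1.1.val
def ix {r c : ℕ} (v : Vt r c) : ℕ := v.1.2.1.val
def ps {r c : ℕ} (v : Vt r c) : ℕ := v.1.2.2.val

theorem vext {r c : ℕ} {u v : Vt r c} (h1 : lv u = lv v) (h2 : ix u = ix v) (h3 : ps u = ps v) :
    u = v :=
  Subtype.ext (Prod.ext (Fin.ext h1) (Prod.ext (Fin.ext h2) (Fin.ext h3)))

theorem lv_le {r c : ℕ} (v : Vt r c) : lv v ≤ r := Nat.lt_succ_iff.1 v.1.1.isLt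
theorem ix_lt {r c : ℕ} (v : Vt r c) : ix v < c := v.1.2.1.isLt
theorem ps_lt {r c : ℕ} (v : Vt r c) : ps v < r * c := v.1.2.2.isLt
theorem ix_top {r c : ℕ} (v : Vt r c) (h : lv v = r) : ix v = 0 := v.2 h

theorem exists_vt {r c : ℕ} (l i p : ℕ) (hl : l ≤ r) (hi : i < c) (hp : p < r * c)
    (ht : l = r → i = 0) : ∃ v : Vt r c, lv v = l ∧ ix v = i ∧ ps v = p :=
  ⟨⟨(⟨l, by omega⟩, ⟨i, hi⟩, ⟨p, hp⟩), ht⟩, rfl, rfl, rfl⟩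

/-- The graph. -/
abbrev Gr (r c : ℕ) : FinDigraph where
  V := Vt r c
  Edge u v := (lv u = lv v ∧ ix u = ix v ∧ ps u + 1 = ps v) ∨
    (lv u + 1 = lv v ∧ ix u = ps v % c ∧ ps u + 1 = r * c)

theorem edge_iff {r c : ℕ} (u v : Vt r c) : (Gr r c).Edge u v ↔
    ((lv u = lv v ∧ ix u = ix v ∧ ps u + 1 = ps v) ∨
    (lv u + 1 = lv v ∧ ix u = ps v % c ∧ ps u + 1 = r * c)) := Iff.rfl

theorem edge_irrefl (r c : ℕ) (v : (Gr r c).V) : ¬ (Gr r c).Edge v v := by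
  intro h
  rcases (edge_iff v v).1 h with h | h <;> omega

theorem acyclic (r c : ℕ) : (Gr r c).Acyclic := by
  have key : ∀ u v : Vt r c, Relation.TransGen (Gr r c).Edge u v →
      lv u < lv v ∨ (lv u = lv v ∧ ps u < ps v) := by
    intro u v h
    have he : ∀ u v : Vt r c, (Gr r c).Edge u v → lv u < lv v ∨ (lv u = lv v ∧ ps u < ps v) := by
      intro u v h
      rcases (edge_iff u v).1 h with h | h <;> omega
    induction h with
    | single h => exact he _ _ h
    | tail _ h ih => have := he _ _ h; omega
  intro v h
  have := key v v h
  omega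

theorem indeg (r c : ℕ) (v : (Gr r c).V) : ((Gr r c).pred v).ncard ≤ 2 := by
  have hsub : (Gr r c).pred v ⊆ {u : Vt r c | lv u = lv (v : Vt r c) ∧ ix u = ix (v : Vt r c) ∧ ps u + 1 = ps (v : Vt r c)} ∪
    {u : Vt r c | lv u + 1 = lv (v : Vt r c) ∧ ix u = ps (v : Vt r c) % c ∧ ps u + 1 = r * c} :=
    fun u hu => hu
  refine (Set.ncard_le_ncard hsub (Set.toFinite _)).trans ((Set.ncard_union_le _ _).trans ?_)
  apply Nat.add_le_add (b := 1) (d := 1)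
  · refine (Set.ncard_le_one (Set.toFinite _)).2 ?_
    rintro a ⟨h1, h2, h3⟩ b ⟨h4, h5, h6⟩
    exact vext (by omega) (by omega) (by omega)
  · refine (Set.ncard_le_one (Set.toFinite _)).2 ?_
    rintro a ⟨h1, h2, h3⟩ b ⟨h4, h5, h6⟩
    exact vext (by omega) (by omega) (by omega)

theorem uniqueSink (r c : ℕ) (hr : 1 ≤ r) (hc : 1 ≤ c) (z : Vt r c) (h1 : lv z = r)
    (h3 : ps z + 1 = r * c) : (Gr r c).UniqueSink z := by
  have hrc : 1 ≤ r * c := Nat.mul_pos hr hc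
  constructor
  · intro u h
    have := lv_le u
    have := ps_lt u
    rcases (edge_iff z u).1 h with h | h <;> omega
  · intro v hv
    change Vt r c at v
    have hl := lv_le v
    have hp := ps_lt v
    by_cases hpv : ps v + 1 < r * c
    · obtain ⟨u, a1, a2, a3⟩ := exists_vt (r := r) (c := c) (lv v) (ix v) (ps v + 1) hl (ix_lt v) hpv
        (ix_top v)
      exact absurd ((edge_iff v u).2 (Or.inl ⟨a1.symm, a2.symm, a3.symm⟩)) (hv u)
    · by_cases hlv : lv v < r
      · have hi := ix_lt v
        have : c ≤ r * c := Nat.le_mul_of_pos_left _ hr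
        obtain ⟨u, a1, a2, a3⟩ := exists_vt (r := r) (c := c) (lv v + 1) 0 (ix v) hlv hc (by omega)
          (fun _ => rfl)
        refine absurd ((edge_iff v u).2 (Or.inr ⟨a1.symm, ?_, by omega⟩)) (hv u)
        rw [a3, Nat.mod_eq_of_lt hi]
      · have hvr : lv v = r := by omega
        exact vext (by omega) (by rw [ix_top v hvr, ix_top z h1]) (by omega)

theorem card_le (r c : ℕ) : Fintype.card (Gr r c).V ≤ (r + 1) * (c * (r * c)) := by
  have : Fintype.card (Vt r c) ≤ Fintype.card (Fin (r + 1) × Fin c × Fin (r * c)) :=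
    Fintype.card_subtype_le _
  simp only [Fintype.card_prod, Fintype.card_fin] at this
  exact le_trans (le_of_eq (Fintype.card_congr (Equiv.refl (Vt r c)))) this

theorem le_card (r c : ℕ) : r * (c * (r * c)) ≤ Fintype.card (Gr r c).V := by
  have : Fintype.card (Fin r × Fin c × Fin (r * c)) ≤ Fintype.card (Gr r c).V := by
    refine Fintype.card_le_of_injective
      (fun x => (⟨(⟨x.1.val, by omega⟩, x.2.1, x.2.2), fun h => by
        have := x.1.isLt; simp at h; omega⟩ : Vt r c)) ?_
    intro x y h
    have h := Subtype.ext_iff.1 h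
    simp only [Prod.mk.injEq, Fin.mk.injEq] at h
    exact Prod.ext (Fin.ext h.1) (Prod.ext h.2.1 h.2.2)
  simpa [Fintype.card_prod, Fintype.card_fin] using this

/-! ### Lower bound -/

theorem lower_aux (r c : ℕ) (hc : 1 ≤ c) (P : ℕ → Set (Gr r c).V) (t : ℕ)
    (hP : ∀ i < t, (Gr r c).StdMove (P i) (P (i + 1))) :
    ∀ (l i σ τ : ℕ) (T : ℕ), l ≤ r → i < c → (l = r → i = 0) → σ ≤ τ → τ ≤ t → 
      (∀ v : Vt r c, lv v = l → ix v = i → v ∉ P σ) →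
      (∀ v : Vt r c, lv v = l → ix v = i → ps v + 1 = r * c → v ∈ P τ) →
      1 ≤ r → 
      (∀ σ' τ', σ' ≤ τ' → τ' ≤ t → (0 < l ∧ ∀ j < c, ∃ v : Vt r c, lv v + 1 = l ∧ ix v = j ∧ ps v + 1 = r * c ∧
        ∃ x, σ' ≤ x ∧ x ≤ τ' ∧ v ∈ P x) → T ≤ τ' - σ') →
      (l = 0 → T = 0) → r * T + 1 ≤ τ - σ := by
  classical
  intro l i σ τ T hl hi htop hst htt hempty hlast hr hT hl0
  have hrc : 1 ≤ r * c := Nat.mul_pos hr hc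
  -- first time a vertex of the spine is pebbled
  have first : ∀ (v : Vt r c) (x : ℕ), lv v = l → ix v = i → σ ≤ x → x ≤ t → v ∈ P x →
      ∃ e, σ ≤ e ∧ e < x ∧ (Gr r c).pred v ⊆ P e := by
    intro v x h1 h2 hx
    induction x, hx using Nat.le_induction with
    | base => intro _ h; exact absurd h (hempty v h1 h2)
    | succ x hx ih =>
      intro hxt hv
      by_cases hvx : v ∈ P x
      · obtain ⟨e, e1, e2, e3⟩ := ih (by omega) hvx
        exact ⟨e, e1, by omega, e3⟩
      · rcases hP x (by omega) with ⟨u, u1, u2, u3⟩ | ⟨u, u1, u2⟩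
        · rw [u3] at hv
          rcases hv with rfl | hv
          · exact ⟨x, hx, by omega, u1⟩
          · exact absurd hv hvx
        · rw [u2] at hv
          exact absurd hv.1 hvx
  -- a descending chain of times
  have chain : ∀ d : ℕ, d < r * c → ∃ e : ℕ → ℕ, e (r * c) = τ ∧ 
      (∀ p, r * c - 1 - d ≤ p → p < r * c → σ ≤ e p ∧ e p < e (p + 1) ∧
        ∀ v : Vt r c, lv v = l → ix v = i → ps v = p → (Gr r c).pred v ⊆ P (e p)) := by
    intro d
    induction d with
    | zero =>
      intro _
      obtain ⟨v, v1, v2, v3⟩ := exists_vt (r := r) (c := c) l i (r * c - 1) hl hi (by omega) htop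
      obtain ⟨x, x1, x2, x3⟩ := first v τ v1 v2 hst htt (hlast v v1 v2 (by omega))
      refine ⟨fun p => if p = r * c then τ else x, by simp, ?_⟩
      intro p h1 h2
      obtain rfl : p = r * c - 1 := by omega
      have e1 : r * c - 1 ≠ r * c := by omega
      have e2 : r * c - 1 + 1 = r * c := by omega
      simp only [e1, e2, if_true, if_false]
      refine ⟨x1, x2, ?_⟩
      intro w w1 w2 w3
      rw [vext (w1.trans v1.symm) (w2.trans v2.symm) (w3.trans v3.symm)]
      exact x3
    | succ d ih =>
      intro hd
      obtain ⟨e, eτ, he⟩ := ih (by omega)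
      have hle : ∀ k p, p + k = r * c → r * c - 1 - d ≤ p → e p ≤ τ := by
        intro k
        induction k with
        | zero => intro p h _; rw [← eτ, ← h]; simp
        | succ k ihk =>
          intro p h h'
          have := ihk (p + 1) (by omega) (by omega)
          have := (he p h' (by omega)).2.1
          omega
      set q := r * c - 1 - d with hq
      obtain ⟨v, v1, v2, v3⟩ := exists_vt (r := r) (c := c) l i (q - 1) hl hi (by omega) htop
      obtain ⟨w, w1, w2, w3⟩ := exists_vt (r := r) (c := c) l i q hl hi (by omega) htop
      have hq' := he q le_rfl (by omega)
      have hvP : v ∈ P (e q) := hq'.2.2 w w1 w2 w3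
        ((edge_iff v w).2 (Or.inl ⟨by omega, by omega, by omega⟩))
      have := hle (d + 1) q (by omega) le_rfl
      obtain ⟨x, x1, x2, x3⟩ := first v (e q) v1 v2 hq'.1 (by omega) hvP
      refine ⟨fun p => if p = q - 1 then x else e p, ?_, ?_⟩
      · have : r * c ≠ q - 1 := by omega
        simp [this, eτ]
      · intro p h1 h2
        by_cases hp : p = q - 1
        · subst hp
          have e2 : q - 1 + 1 = q := by omega
          have e3 : q ≠ q - 1 := by omega
          simp only [e2, e3, if_true, if_false]
          refine ⟨x1, x2, ?_⟩
          intro w w1 w2 w3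
          rw [vext (w1.trans v1.symm) (w2.trans v2.symm) (w3.trans v3.symm)]
          exact x3
        · have e3 : p + 1 ≠ q - 1 := by omega
          simp only [hp, e3, if_false]
          exact he p (by omega) h2
  obtain ⟨e, eτ, he⟩ := chain (r * c - 1) (by omega)
  have hmono : ∀ k p, p + k ≤ r * c → e p + k ≤ e (p + k) := by
    intro k
    induction k with
    | zero => intro p _; simp
    | succ k ihk =>
      intro p h
      have := ihk p (by omega)
      have := (he (p + k) (by omega) (by omega)).2.1
      rw [show p + (k + 1) = p + k + 1 by omega]
      omega
  have hmono' : ∀ p q, p ≤ q → q ≤ r * c → e p ≤ e q := by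
    intro p q h1 h2
    have := hmono (q - p) p (by omega)
    rw [show p + (q - p) = q by omega] at this
    omega
  have hmain : ∀ k, k < r → e 0 + (k + 1) * T ≤ e (k * c + (c - 1)) := by
    intro k
    induction k with
    | zero =>
      intro h
      have hcr : c ≤ r * c := Nat.le_mul_of_pos_left _ hr
      by_cases hl' : l = 0
      · simp [hl0 hl']; exact hmono' _ _ (by omega) (by omega)
      have := hT (e 0) (e (c - 1)) (hmono' _ _ (by omega) (by omega))
        (by rw [← eτ] at htt; exact (hmono' _ _ (by omega) le_rfl).trans htt) ⟨by omega, fun j hj => by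
          obtain ⟨v, v1, v2, v3⟩ := exists_vt (r := r) (c := c) (l - 1) j (r * c - 1) (by omega) hj (by omega) (by omega)
          obtain ⟨w, w1, w2, w3⟩ := exists_vt (r := r) (c := c) l i j hl hi (by omega) htop
          refine ⟨v, by omega, v2, by omega, e j, hmono' _ _ (by omega) (by omega), hmono' _ _ (by omega) (by omega), ?_⟩
          refine (he j (by omega) (by omega)).2.2 w w1 w2 w3 ((edge_iff v w).2 (Or.inr ⟨by omega, ?_, by omega⟩))
          rw [w3, v2, Nat.mod_eq_of_lt hj]⟩
      have := hmono' 0 (c - 1) (by omega) (by omega)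
      simp only [Nat.zero_mul, Nat.zero_add, Nat.one_mul]
      omega
    | succ k ih =>
      intro h
      have ih := ih (by omega)
      have hcr : (k + 1) * c + c ≤ r * c := by
        have := Nat.mul_le_mul_right c (show k + 1 + 1 ≤ r by omega)
        linarith [show (k + 1 + 1) * c = (k + 1) * c + c by ring]
      have hkc : (k + 1) * c = k * c + c := by ring
      have h3 := hmono' (k * c + (c - 1)) ((k + 1) * c) (by omega) (by omega)
      by_cases hl' : l = 0
      · have h4 := hmono' ((k + 1) * c) ((k + 1) * c + (c - 1)) (by omega) (by omega)
        simp only [hl0 hl', Nat.mul_zero, Nat.add_zero] at ih ⊢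
        omega
      have := hT (e ((k + 1) * c)) (e ((k + 1) * c + (c - 1))) (hmono' _ _ (by omega) (by omega))
        (by rw [← eτ] at htt; exact (hmono' _ _ (by omega) le_rfl).trans htt) ⟨by omega, fun j hj => by
          obtain ⟨v, v1, v2, v3⟩ := exists_vt (r := r) (c := c) (l - 1) j (r * c - 1) (by omega) hj (by omega) (by omega)
          obtain ⟨w, w1, w2, w3⟩ := exists_vt (r := r) (c := c) l i ((k + 1) * c + j) hl hi (by omega) htop
          refine ⟨v, by omega, v2, by omega, e ((k + 1) * c + j), hmono' _ _ (by omega) (by omega), hmono' _ _ (by omega) (by omega), ?_⟩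
          refine (he _ (by omega) (by omega)).2.2 w w1 w2 w3 ((edge_iff v w).2 (Or.inr ⟨by omega, ?_, by omega⟩))
          rw [w3, v2, Nat.add_comm, Nat.add_mul_mod_self_right, Nat.mod_eq_of_lt hj]⟩
      have h4 := hmono' ((k + 1) * c) ((k + 1) * c + (c - 1)) (by omega) (by omega)
      have h5 : (k + 1 + 1) * T = (k + 1) * T + T := by ring
      omega
  have h1 := hmain (r - 1) (by omega)
  have h2 : (r - 1) * c + (c - 1) + 1 = r * c := by
    obtain ⟨r', rfl⟩ : ∃ r', r = r' + 1 := ⟨r - 1, by omega⟩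
    simp only [Nat.add_sub_cancel]
    have : (r' + 1) * c = r' * c + c := by ring
    omega
  have h3 := (he ((r - 1) * c + (c - 1)) (by omega) (by omega)).2.1
  rw [h2, eτ] at h3
  have h4 := (he 0 (by omega) (by omega)).1
  rw [show r - 1 + 1 = r by omega] at h1
  omega

theorem exists_empty_spine (r c l : ℕ) (P : Set (Gr r c).V) (h : P.ncard < c) :
    ∃ i < c, ∀ v : Vt r c, lv v = l → ix v = i → v ∉ P := by
  classical
  by_contra hcon
  push Not at hcon
  have hsub : Set.Iio c ⊆ Set.image (fun v : Vt r c => ix v) P := by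
    intro i hi
    obtain ⟨v, _, h2, h3⟩ := hcon i hi
    exact ⟨v, h3, h2⟩
  have h1 := Set.ncard_le_ncard hsub (Set.toFinite _)
  have h2 := Set.ncard_image_le (f := fun v : Vt r c => ix v) (Set.toFinite P)
  rw [Set.ncard_Iio_nat] at h1
  omega

theorem lower_level (r c : ℕ) (hr : 1 ≤ r) (hc : 1 ≤ c) (P : ℕ → Set (Gr r c).V) (t : ℕ)
    (hP : ∀ i < t, (Gr r c).StdMove (P i) (P (i + 1))) (hs : ∀ i ≤ t, (P i).ncard < c) (l : ℕ) :
    l < r → ∀ σ τ, σ ≤ τ → τ ≤ t → 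
      (∀ j < c, ∃ v : Vt r c, lv v = l ∧ ix v = j ∧ ps v + 1 = r * c ∧
        ∃ x, σ ≤ x ∧ x ≤ τ ∧ v ∈ P x) → r ^ l ≤ τ - σ := by
  induction l with
  | zero =>
    intro hl σ τ h1 h2 h3
    obtain ⟨i, hi, he⟩ := exists_empty_spine r c 0 (P σ) (hs σ (by omega))
    obtain ⟨v, v1, v2, v3, x, x1, x2, x3⟩ := h3 i hi
    have := lower_aux r c hc P t hP 0 i σ x 0 (by omega) hi (by omega) x1 (by omega) he
      (fun w w1 w2 w3 => by rwa [vext (w1.trans v1.symm) (w2.trans v2.symm) (by omega : ps w = ps v)])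
      hr (fun _ _ _ _ _ => by omega) (fun _ => rfl)
    simp only [pow_zero]
    omega
  | succ l ih =>
    intro hl σ τ h1 h2 h3
    obtain ⟨i, hi, he⟩ := exists_empty_spine r c (l + 1) (P σ) (hs σ (by omega))
    obtain ⟨v, v1, v2, v3, x, x1, x2, x3⟩ := h3 i hi
    have := lower_aux r c hc P t hP (l + 1) i σ x (r ^ l) (by omega) hi (by omega) x1 (by omega) he
      (fun w w1 w2 w3 => by rwa [vext (w1.trans v1.symm) (w2.trans v2.symm) (by omega : ps w = ps v)])
      hr (fun σ' τ' a1 a2 a3 => ih (by omega) σ' τ' a1 a2 (fun j hj => by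
        obtain ⟨u, u1, u2⟩ := a3.2 j hj
        exact ⟨u, by omega, u2⟩)) (fun h => by omega)
    rw [pow_succ']
    omega

theorem lower (r c : ℕ) (hr : 1 ≤ r) (hc : 1 ≤ c) (z : Vt r c) (h1 : lv z = r)
    (h3 : ps z + 1 = r * c) (P : ℕ → Set (Gr r c).V) (t : ℕ)
    (h : (Gr r c).IsStdPebbling z t P) (hs : (Gr r c).space t P < c) : r ^ r ≤ t := by
  obtain ⟨h0, ht, ⟨τ, hτ, hz⟩, hm⟩ := h
  have hs' : ∀ i ≤ t, (P i).ncard < c := fun i hi =>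
    lt_of_le_of_lt (Finset.le_sup (f := fun i => (P i).ncard) (Finset.mem_range.2 (by omega))) hs
  have := lower_aux r c hc P t hm r 0 0 τ (r ^ (r - 1)) le_rfl hc (fun _ => rfl) (by omega) hτ
    (fun v _ _ hv => by rw [h0] at hv; exact hv)
    (fun w w1 w2 w3 => by
      rwa [vext (w1.trans h1.symm) (w2.trans (ix_top z h1).symm) (by omega : ps w = ps z)])
    hr (fun σ' τ' a1 a2 a3 => lower_level r c hr hc P t hm hs' (r - 1) (by omega) σ' τ' a1 a2
      (fun j hj => by
        obtain ⟨u, u1, u2⟩ := a3.2 j hj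
        exact ⟨u, by omega, u2⟩)) (fun h => by omega)
  rw [← pow_succ', show r - 1 + 1 = r by omega] at this
  omega

/-! ### Upper bounds -/

/-- Pebbles on spine `i` of level `l` according to a line configuration. -/
def sp (r c l i : ℕ) (s : Finset ℕ) : Set (Vt r c) := {v | lv v = l ∧ ix v = i ∧ ps v + 1 ∈ s}

/-- The last vertex of spine `i` of level `l`. -/
def lst (r c l i : ℕ) : Set (Vt r c) := {v | lv v = l ∧ ix v = i ∧ ps v + 1 = r * c}

theorem sp_ncard (r c l i : ℕ) (s : Finset ℕ) : (sp r c l i s).ncard ≤ s.card := by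
  rw [← Set.ncard_coe_finset]
  refine Set.ncard_le_ncard_of_injOn (fun v => ps v + 1) (fun v hv => hv.2.2) ?_ (Set.toFinite _)
  rintro u ⟨a1, a2, a3⟩ v ⟨b1, b2, b3⟩ h
  have h : ps u + 1 = ps v + 1 := h
  exact vext (by omega) (by omega) (by omega)

theorem lst_ncard (r c l i : ℕ) : (lst r c l i).ncard ≤ 1 := by
  refine (Set.ncard_le_one (Set.toFinite _)).2 ?_
  rintro u ⟨a1, a2, a3⟩ v ⟨b1, b2, b3⟩
  exact vext (by omega) (by omega) (by omega)

theorem single_move (r c cap : ℕ) (C : Set (Vt r c)) (v : Vt r c) (hv : v ∉ C)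
    (hp : ∀ u : Vt r c, (Gr r c).Edge u v → u ∈ C) (hc : C.ncard + 1 ≤ cap) :
    CM (Gr r c) cap C (insert v C) :=
  ⟨⟨v, hp, Or.inl ⟨hv, rfl⟩⟩, by omega, (Set.ncard_insert_le v C).trans hc⟩

theorem spine_walk (r c l i cap t j m : ℕ) (hrc : 1 ≤ r * c) (hl : l ≤ r) (hi : i < c)
    (htop : l = r → i = 0) (hm : r * c ≤ (j + 1) ^ m) (R : Set (Vt r c))
    (H : ∀ s : Finset ℕ, s.card + 1 ≤ m * j + 2 → ∀ v : Vt r c, lv v = l → ix v = i → ps v ∈ s →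
      ps v + 1 ∉ s → Walk (CM (Gr r c) cap) t (R ∪ sp r c l i s) (insert v (R ∪ sp r c l i s))) :
    Walk (CM (Gr r c) cap) ((2 * j + 1) ^ m * t) R (R ∪ lst r c l i) := by
  have key : ∀ s : Finset ℕ, ∀ q < r * c, q ∈ s → q + 1 ∉ s → (insert (q + 1) s).card ≤ m * j + 2 →
      Walk (CM (Gr r c) cap) t (R ∪ sp r c l i s) (R ∪ sp r c l i (insert (q + 1) s)) := by
    intro s q hq hqs hqs' hcard
    rw [Finset.card_insert_of_notMem hqs'] at hcard
    obtain ⟨v, v1, v2, v3⟩ := exists_vt (r := r) (c := c) l i q hl hi hq htop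
    have := H s hcard v v1 v2 (by rwa [v3]) (by rwa [v3])
    convert this using 1
    rw [← Set.union_insert]
    congr 1
    ext u
    simp only [sp, Finset.mem_insert, Set.mem_ofPred_eq, Set.mem_insert_iff]
    constructor
    · rintro ⟨u1, u2, u3 | u3⟩
      · exact Or.inl (vext (by omega) (by omega) (by omega))
      · exact Or.inr ⟨u1, u2, u3⟩
    · rintro (rfl | ⟨u1, u2, u3⟩)
      · exact ⟨v1, v2, Or.inl (by omega)⟩
      · exact ⟨u1, u2, Or.inr u3⟩
  have := Walk.lift (M' := CM (Gr r c) cap) (fun s => R ∪ sp r c l i s) t (fun s s' h => by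
    obtain ⟨⟨q, hq, hqs, h⟩, c1, c2⟩ := h
    rcases h with ⟨h, rfl⟩ | ⟨h, rfl⟩
    · exact key s q hq hqs h c2
    · have := key (s.erase (q + 1)) q hq (by simp [hqs]) (by simp) (by rwa [Finset.insert_erase h])
      rw [Finset.insert_erase h] at this
      exact this.symm (CM.symm _ (edge_irrefl r c) cap)) (line (r * c) j m hrc hm)
  have e1 : R ∪ sp r c l i {0} = R := by
    have : sp r c l i {0} = ∅ := by ext; simp [sp]
    rw [this, Set.union_empty]
  have e2 : sp r c l i {r * c, 0} = lst r c l i := by ext; simp [sp, lst]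
  simp only [e1, e2] at this
  exact this

theorem price (r c cap m : ℕ) (hr : 1 ≤ r) (hc : 1 ≤ c) (hm : r * c ≤ 2 ^ m) (l : ℕ) : l ≤ r →
    ∃ T, ∀ i < c, (l = r → i = 0) → ∀ R : Set (Vt r c), (∀ v ∈ R, l ≤ lv v) →
      (∀ v ∈ R, ¬ (lv v = l ∧ ix v = i)) → R.ncard + (l + 1) * (m + 3) ≤ cap →
      Walk (CM (Gr r c) cap) T R (R ∪ lst r c l i) := by
  have hrc : 1 ≤ r * c := Nat.mul_pos hr hc
  have hnot : ∀ (l i : ℕ) (R : Set (Vt r c)) (s : Finset ℕ) (v : Vt r c),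
      (∀ v ∈ R, ¬ (lv v = l ∧ ix v = i)) → lv v = l → ix v = i → ps v + 1 ∉ s →
      v ∉ R ∪ sp r c l i s := by
    rintro l i R s v h1 h2 h3 h4 (h | h)
    · exact h1 v h ⟨h2, h3⟩
    · exact h4 h.2.2
  have hcard : ∀ (l i : ℕ) (R : Set (Vt r c)) (s : Finset ℕ),
      (R ∪ sp r c l i s).ncard ≤ R.ncard + s.card := fun l i R s =>
    (Set.ncard_union_le _ _).trans (Nat.add_le_add_left (sp_ncard r c l i s) _)
  induction l with
  | zero =>
    intro hl
    refine ⟨_, fun i hi htop R hR hR' hcap => spine_walk r c 0 i cap 1 1 m hrc hl hi htop hm R ?_⟩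
    intro s hs v v1 v2 v3 v4
    refine Walk.single (single_move r c cap _ v (hnot 0 i R s v hR' v1 v2 v4) ?_ ?_)
    · intro u hu
      rcases (edge_iff u v).1 hu with ⟨h1, h2, h3⟩ | h
      · exact Or.inr ⟨by omega, by omega, by rwa [h3]⟩
      · omega
    · have := hcard 0 i R s
      omega
  | succ l ih =>
    intro hl
    obtain ⟨T, hT⟩ := ih (by omega)
    refine ⟨_, fun i hi htop R hR hR' hcap =>
      spine_walk r c (l + 1) i cap (T + 1 + T) 1 m hrc hl hi htop hm R ?_⟩
    intro s hs v v1 v2 v3 v4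
    have hC := hcard (l + 1) i R s
    have hv := hnot (l + 1) i R s v hR' v1 v2 v4
    have hlev : ∀ u ∈ R ∪ sp r c (l + 1) i s, l + 1 ≤ lv u := by
      rintro u (h | h)
      · exact hR u h
      · exact h.1.symm.le
    have hedge : ∀ u : Vt r c, (Gr r c).Edge u v →
        u ∈ (R ∪ sp r c (l + 1) i s) ∪ lst r c l (ps v % c) := by
      intro u hu
      rcases (edge_iff u v).1 hu with ⟨h1, h2, h3⟩ | ⟨h1, h2, h3⟩
      · exact Or.inl (Or.inr ⟨by omega, by omega, by rwa [h3]⟩)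
      · exact Or.inr ⟨by omega, h2, h3⟩
    generalize R ∪ sp r c (l + 1) i s = C at *
    have hmc : ps v % c < c := Nat.mod_lt _ hc
    have e : (l + 1 + 1) * (m + 3) = (l + 1) * (m + 3) + (m + 3) := by ring
    have hC' := Set.ncard_insert_le v C
    have w1 := hT (ps v % c) hmc (by omega) C (fun u hu => by have := hlev u hu; omega)
      (fun u hu => by have := hlev u hu; omega) (by omega)
    have w3 := hT (ps v % c) hmc (by omega) (insert v C)
      (fun u hu => by
        rcases hu with rfl | hu
        · omega
        · have := hlev u hu; omega)
      (fun u hu => by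
        rcases hu with rfl | hu
        · omega
        · have := hlev u hu; omega) (by omega)
    have w2 := single_move r c cap (C ∪ lst r c l (ps v % c)) v
      (by
        rintro (h | h)
        · exact hv h
        · have := h.1; omega) hedge
      (by
        have h1 := Set.ncard_union_le C (lst r c l (ps v % c))
        have h2 := lst_ncard r c l (ps v % c)
        have h3 : 3 ≤ (l + 1) * (m + 3) := by nlinarith
        omega)
    rw [Set.insert_union] at w3
    exact (w1.trans (Walk.single w2)).trans (w3.symm (CM.symm _ (edge_irrefl r c) cap))

theorem level_walk (r c cap j m q : ℕ) (hr : 1 ≤ r) (hc : 1 ≤ c) (hm : r * c ≤ (j + 1) ^ m)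
    (hq : q ≤ r) (R : Set (Vt r c))
    (h1 : ∀ v : Vt r c, lv v + 1 = q → ps v + 1 = r * c → v ∈ R) (h2 : ∀ v ∈ R, lv v ≠ q)
    (hcap : R.ncard + c + (m * j + 2) ≤ cap) :
    Walk (CM (Gr r c) cap) (c * (2 * j + 1) ^ m) R
      (R ∪ {v : Vt r c | lv v = q ∧ ps v + 1 = r * c}) := by
  have hrc : 1 ≤ r * c := Nat.mul_pos hr hc
  have main : ∀ i ≤ c, Walk (CM (Gr r c) cap) (i * (2 * j + 1) ^ m) R
      (R ∪ {v : Vt r c | lv v = q ∧ ix v < i ∧ ps v + 1 = r * c}) := by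
    intro i
    induction i with
    | zero =>
      intro _
      have : {v : Vt r c | lv v = q ∧ ix v < 0 ∧ ps v + 1 = r * c} = ∅ := by ext; simp
      rw [this, Set.union_empty]
      exact .refl _ _
    | succ i ih =>
      intro hi
      have w := ih (by omega)
      have e : {v : Vt r c | lv v = q ∧ ix v < i + 1 ∧ ps v + 1 = r * c} =
          {v : Vt r c | lv v = q ∧ ix v < i ∧ ps v + 1 = r * c} ∪ lst r c q i := by
        ext v
        simp only [lst, Set.mem_ofPred_eq, Set.mem_union]
        omega
      by_cases htop : q = r → i = 0
      · rw [e, ← Set.union_assoc]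
        refine (w.trans (spine_walk r c q i cap 1 j m hrc hq (by omega) htop hm _ ?_)).mono
          (by apply le_of_eq; ring)
        intro s hs v v1 v2 v3 v4
        refine Walk.single (single_move r c cap _ v ?_ ?_ ?_)
        · rintro ((h | h) | h)
          · exact h2 v h v1
          · have := h.2.1; omega
          · exact v4 h.2.2
        · intro u hu
          rcases (edge_iff u v).1 hu with ⟨h1, h2, h3⟩ | ⟨a1, a2, a3⟩
          · exact Or.inr ⟨by omega, by omega, by rwa [h3]⟩
          · exact Or.inl (Or.inl (h1 u (by omega) a3))
        · have c1 := Set.ncard_union_le (R ∪ {v : Vt r c | lv v = q ∧ ix v < i ∧ ps v + 1 = r * c})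
            (sp r c q i s)
          have c2 := Set.ncard_union_le R {v : Vt r c | lv v = q ∧ ix v < i ∧ ps v + 1 = r * c}
          have c3 := sp_ncard r c q i s
          have c4 : {v : Vt r c | lv v = q ∧ ix v < i ∧ ps v + 1 = r * c}.ncard ≤ (Set.Iio c).ncard := by
            refine Set.ncard_le_ncard_of_injOn (fun v => ix v) (fun v _ => ix_lt v) ?_ (Set.toFinite _)
            rintro u ⟨a1, a2, a3⟩ v ⟨b1, b2, b3⟩ h
            exact vext (by omega) h (by omega)
          rw [Set.ncard_Iio_nat] at c4
          omega
      · have e' : lst r c q i = ∅ := by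
          ext v
          simp only [lst, Set.mem_ofPred_eq, Set.mem_empty_iff_false, iff_false]
          rintro ⟨a1, a2, a3⟩
          have := ix_top v
          omega
        rw [e, e', Set.union_empty]
        exact w.mono (Nat.mul_le_mul_right _ (by omega))
  have := main c le_rfl
  have e : {v : Vt r c | lv v = q ∧ ps v + 1 = r * c} =
      {v : Vt r c | lv v = q ∧ ix v < c ∧ ps v + 1 = r * c} := by
    ext v
    have := ix_lt v
    simp only [Set.mem_ofPred_eq]
    omega
  rw [e]
  exact this

theorem fast (r c cap j m m' : ℕ) (hr : 1 ≤ r) (hc : 1 ≤ c) (hm : r * c ≤ (j + 1) ^ m)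
    (hm' : r + 1 ≤ (j + 1) ^ m') (z : Vt r c) (h1 : lv z = r) (h3 : ps z + 1 = r * c)
    (hcap : (m' * j + 2) * c + c + (m * j + 2) ≤ cap) :
    Walk (CM (Gr r c) cap) ((2 * j + 1) ^ m' * (c * (2 * j + 1) ^ m)) ∅ {z} := by
  let F : Finset ℕ → Set (Vt r c) := fun s => {v | lv v + 1 ∈ s ∧ ps v + 1 = r * c}
  have hF : ∀ s, (F s).ncard ≤ s.card * c := by
    intro s
    have : (F s).ncard ≤ ((s ×ˢ Finset.range c : Finset (ℕ × ℕ)) : Set (ℕ × ℕ)).ncard := by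
      refine Set.ncard_le_ncard_of_injOn (fun v => (lv v + 1, ix v)) ?_ ?_ (Set.toFinite _)
      · intro v hv
        simp [hv.1, ix_lt v]
      · rintro u ⟨a1, a2⟩ v ⟨b1, b2⟩ h
        simp only [Prod.mk.injEq] at h
        exact vext (by omega) h.2 (by omega)
    rwa [Set.ncard_coe_finset, Finset.card_product, Finset.card_range] at this
  have key : ∀ s : Finset ℕ, ∀ q < r + 1, q ∈ s → q + 1 ∉ s → s.card ≤ m' * j + 2 →
      Walk (CM (Gr r c) cap) (c * (2 * j + 1) ^ m) (F s) (F (insert (q + 1) s)) := by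
    intro s q hq hqs hqs' hcard
    have := level_walk r c cap j m q hr hc hm (by omega) (F s)
      (fun v v1 v2 => ⟨by rwa [v1], v2⟩)
      (fun v hv he => hqs' (by rw [← he]; exact hv.1))
      (by
        have := hF s
        have := Nat.mul_le_mul_right c hcard
        omega)
    convert this using 1
    ext u
    simp only [F, Finset.mem_insert, Set.mem_ofPred_eq, Set.mem_union, Nat.add_right_cancel_iff]
    tauto
  have := Walk.lift (M' := CM (Gr r c) cap) F _ (fun s s' h => by
    obtain ⟨⟨q, hq, hqs, h⟩, c1, c2⟩ := h
    rcases h with ⟨h, rfl⟩ | ⟨h, rfl⟩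
    · exact key s q hq hqs h c1
    · have := key (s.erase (q + 1)) q hq (by simp [hqs]) (by simp) c2
      rw [Finset.insert_erase h] at this
      exact this.symm (CM.symm _ (edge_irrefl r c) cap)) (line (r + 1) j m' (by omega) hm')
  have e1 : F {0} = ∅ := by ext; simp [F]
  have e2 : F {r + 1, 0} = {z} := by
    ext v
    simp only [F, Finset.mem_insert, Finset.mem_singleton, Set.mem_ofPred_eq, Set.mem_singleton_iff]
    constructor
    · rintro ⟨a, b⟩
      have hv : lv v = r := by omega
      exact vext (by omega) (by rw [ix_top v hv, ix_top z h1]) (by omega)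
    · rintro rfl
      exact ⟨Or.inl (by omega), h3⟩
  rw [e1, e2] at this
  exact this

theorem price_peb (r c m : ℕ) (hr : 1 ≤ r) (hc : 1 ≤ c) (hm : r * c ≤ 2 ^ m) (z : Vt r c)
    (h1 : lv z = r) (h3 : ps z + 1 = r * c) :
    ∃ t P, (Gr r c).IsRevPebbling z t P ∧ (Gr r c).space t P ≤ (r + 1) * (m + 3) := by
  obtain ⟨T, hT⟩ := price r c ((r + 1) * (m + 3)) m hr hc hm r le_rfl
  have w := hT 0 hc (fun _ => rfl) ∅ (fun v hv => hv.elim) (fun v hv => hv.elim) (by simp)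
  have e : (∅ : Set (Vt r c)) ∪ lst r c r 0 = {z} := by
    rw [Set.empty_union]
    ext v
    simp only [lst, Set.mem_ofPred_eq, Set.mem_singleton_iff]
    constructor
    · rintro ⟨a, a', b⟩
      exact vext (by omega) (by rw [a', ix_top z h1]) (by omega)
    · rintro rfl
      exact ⟨h1, ix_top v h1, h3⟩
  rw [e] at w
  obtain ⟨t, P, p1, _, p3⟩ := toPebbling _ (edge_irrefl r c) z _ _ w
  exact ⟨t, P, p1, p3⟩

/-! ### Numerical estimates -/

theorem pow_clog_le (k N : ℕ) (hk : 2 ≤ k) (hN : 1 ≤ N) : k ^ Nat.clog k N ≤ k * N := by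
  rcases Nat.lt_or_ge 1 N with h | h
  · have h1 := Nat.pow_pred_clog_lt_self (by omega : 1 < k) h
    have h2 := Nat.clog_pos (by omega : 1 < k) h
    obtain ⟨m, hm⟩ : ∃ m, Nat.clog k N = m + 1 := ⟨Nat.clog k N - 1, by omega⟩
    rw [hm] at h1 ⊢
    simp only [Nat.pred_eq_sub_one, Nat.add_sub_cancel] at h1
    rw [pow_succ']
    exact Nat.mul_le_mul_left _ h1.le
  · obtain rfl : N = 1 := by omega
    simp; omega

theorem clog_le_log (k N n : ℕ) (hk : 2 ≤ k) (hN : 1 ≤ N) (hn : 2 ≤ n) (h : N ≤ 8 * n) :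
    (Nat.clog k N : ℝ) ≤ 5 * Real.logb 2 n := by
  have h1 : Nat.clog k N ≤ Nat.clog 2 N := Nat.clog_anti_left (by omega) hk
  have h2 := pow_clog_le 2 N le_rfl hN
  have h3 : 2 ^ Nat.clog 2 N ≤ 2 ^ 4 * n := by omega
  have hn' : (2 : ℝ) ≤ n := by exact_mod_cast hn
  have h4 : ((2 : ℝ) ^ (Nat.clog 2 N : ℕ)) ≤ 2 ^ (4 : ℕ) * n := by exact_mod_cast h3
  have h5 := Real.logb_le_logb_of_le (b := 2) (by norm_num) (by positivity) h4
  rw [Real.logb_mul (by positivity) (by positivity), Real.logb_pow, Real.logb_pow,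
    Real.logb_self_eq_one (by norm_num)] at h5
  have h6 : 1 ≤ Real.logb 2 n := by
    rw [Real.le_logb_iff_rpow_le (by norm_num) (by linarith)]
    simpa using hn'
  have h7 : (Nat.clog k N : ℝ) ≤ Nat.clog 2 N := by exact_mod_cast h1
  push_cast at h5
  linarith

theorem time_le (d N : ℕ) (hd : 1 ≤ d) (hN : 1 ≤ N) (j : ℕ) (hj : j + 1 = 2 ^ d) :
    (((2 * j + 1) ^ Nat.clog (j + 1) N : ℕ) : ℝ) ≤ ((2 : ℝ) ^ d * N) ^ (1 + 1 / (d : ℝ)) := by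
  have hk : 2 ≤ j + 1 := by
    rw [hj]; calc 2 = 2 ^ 1 := rfl
      _ ≤ 2 ^ d := Nat.pow_le_pow_right (by omega) hd
  set m := Nat.clog (j + 1) N with hm
  have h1 := pow_clog_le (j + 1) N hk hN
  rw [← hm, hj] at h1
  have hd' : (0 : ℝ) < d := by exact_mod_cast hd
  have h2 : (((2 ^ d) ^ m : ℕ) : ℝ) ≤ ((2 ^ d * N : ℕ) : ℝ) := by exact_mod_cast h1
  push_cast at h2
  have h3 : ((2 * (2 : ℝ) ^ d) ^ m) = (((2 : ℝ) ^ d) ^ m) ^ (1 + 1 / (d : ℝ)) := by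
    have : (2 * (2 : ℝ) ^ d) = ((2 : ℝ) ^ d) ^ (1 + 1 / (d : ℝ)) := by
      rw [Real.rpow_add (by positivity), Real.rpow_one, one_div,
        Real.pow_rpow_inv_natCast (by norm_num) (by omega)]
      ring
    rw [this, Real.rpow_pow_comm (by positivity)]
  have h4 : (((2 * j + 1) ^ m : ℕ) : ℝ) ≤ ((2 * (2 : ℝ) ^ d) ^ m) := by
    have : (2 * j + 1) ^ m ≤ (2 * 2 ^ d) ^ m := Nat.pow_le_pow_left (by omega) m
    exact_mod_cast this
  refine h4.trans (h3.le.trans ?_)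
  exact Real.rpow_le_rpow (by positivity) h2 (by positivity)

/-- The parameter. -/
noncomputable def par (n : ℕ) : ℕ := ⌊(n : ℝ) ^ ((1 : ℝ) / 6)⌋₊ + 1

theorem par_pos (n : ℕ) : 1 ≤ par n := by unfold par; omega

theorem par_facts (n : ℕ) (hn : 1 ≤ n) : ∃ x : ℝ, 1 ≤ x ∧ x = (n : ℝ) ^ ((1 : ℝ) / 6) ∧ x ^ 6 = n ∧
    x ^ 2 = (n : ℝ) ^ ((1 : ℝ) / 3) ∧ x < par n ∧ (par n : ℝ) ≤ 2 * x := by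
  have hn' : (1 : ℝ) ≤ n := by exact_mod_cast hn
  have h1 : (1 : ℝ) ≤ (n : ℝ) ^ ((1 : ℝ) / 6) := Real.one_le_rpow hn' (by norm_num)
  refine ⟨(n : ℝ) ^ ((1 : ℝ) / 6), h1, rfl, ?_, ?_, ?_, ?_⟩
  · rw [← Real.rpow_natCast, ← Real.rpow_mul (by positivity)]; norm_num
  · rw [← Real.rpow_natCast, ← Real.rpow_mul (by positivity)]; norm_num
  · unfold par; push_cast; exact Nat.lt_floor_add_one _
  · unfold par; push_cast
    have := Nat.floor_le (by positivity : 0 ≤ (n : ℝ) ^ ((1 : ℝ) / 6))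
    linarith

theorem par_bounds (n : ℕ) (hn : 1 ≤ n) : par n + 1 ≤ 8 * n ∧ par n * par n ^ 2 ≤ 8 * n := by
  obtain ⟨x, hx, _, h6, _, h1, h2⟩ := par_facts n hn
  have e1 : x ≤ x ^ 6 := le_self_pow₀ hx (by norm_num)
  have e2 : x ^ 3 ≤ x ^ 6 := pow_le_pow_right₀ hx (by norm_num)
  constructor
  · have : (par n : ℝ) + 1 ≤ 8 * n := by linarith
    exact_mod_cast this
  · have h3 : (par n : ℝ) ^ 3 ≤ (2 * x) ^ 3 := pow_le_pow_left₀ (by positivity) h2 3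
    have : (par n : ℝ) * par n ^ 2 ≤ 8 * n := by nlinarith
    exact_mod_cast this

theorem exists_sink (r c : ℕ) (hr : 1 ≤ r) (hc : 1 ≤ c) :
    ∃ z : Vt r c, lv z = r ∧ ps z + 1 = r * c := by
  have hrc : 1 ≤ r * c := Nat.mul_pos hr hc
  obtain ⟨z, h1, _, h3⟩ := exists_vt (r := r) (c := c) r 0 (r * c - 1) le_rfl hc (by omega) (fun _ => rfl)
  exact ⟨z, h1, by omega⟩

theorem one_le_log (n : ℕ) (hn : 2 ≤ n) : 1 ≤ Real.logb 2 n := by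
  have hn' : (2 : ℝ) ≤ n := by exact_mod_cast hn
  rw [Real.le_logb_iff_rpow_le (by norm_num) (by linarith)]
  simpa using hn'

theorem main_price (n : ℕ) (hn : 2 ≤ n) (z : Vt (par n) (par n ^ 2)) (h1 : lv z = par n)
    (h3 : ps z + 1 = par n * par n ^ 2) :
    ∃ t P, (Gr (par n) (par n ^ 2)).IsRevPebbling z t P ∧
      ((Gr (par n) (par n ^ 2)).space t P : ℝ) ≤ 24 * (n : ℝ) ^ ((1 : ℝ) / 6) * Real.logb 2 n := by
  have hA := par_pos n
  have hc : 1 ≤ par n ^ 2 := Nat.one_le_pow _ _ hA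
  obtain ⟨x, hx, hx', h6, _, hl, hu⟩ := par_facts n (by omega)
  have hb := par_bounds n (by omega)
  obtain ⟨t, P, p1, p2⟩ := price_peb (par n) (par n ^ 2) (Nat.clog 2 (par n * par n ^ 2)) hA hc
    (Nat.le_pow_clog (by norm_num) _) z h1 h3
  refine ⟨t, P, p1, ?_⟩
  have hm := clog_le_log 2 (par n * par n ^ 2) n le_rfl (Nat.mul_pos hA hc) hn hb.2
  have hlog := one_le_log n hn
  have p2' : ((Gr (par n) (par n ^ 2)).space t P : ℝ) ≤
      ((par n : ℝ) + 1) * ((Nat.clog 2 (par n * par n ^ 2) : ℝ) + 3) := by exact_mod_cast p2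
  rw [← hx']
  calc _ ≤ _ := p2'
    _ ≤ (3 * x) * (8 * Real.logb 2 n) := by
      apply mul_le_mul <;> first | positivity | linarith
    _ = _ := by ring

theorem main_fast (ε : ℝ) (hε : 0 < ε) : ∃ C : ℝ, 0 < C ∧ ∀ n : ℕ, 2 ≤ n →
    ∀ z : Vt (par n) (par n ^ 2), lv z = par n → ps z + 1 = par n * par n ^ 2 →
    ∃ t P, (Gr (par n) (par n ^ 2)).IsRevPebbling z t P ∧
      (t : ℝ) ≤ C * (n : ℝ) ^ ((1 : ℝ) + ε) ∧
      ((Gr (par n) (par n ^ 2)).space t P : ℝ) ≤ C * (n : ℝ) ^ ((1 : ℝ) / 3) * Real.logb 2 n := by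
  obtain ⟨d, hd⟩ := exists_nat_one_div_lt hε
  obtain ⟨D, rfl⟩ : ∃ D, D = d + 1 := ⟨_, rfl⟩
  obtain ⟨j, hj⟩ : ∃ j, j + 1 = 2 ^ (d + 1) :=
    ⟨2 ^ (d + 1) - 1, by have := Nat.one_le_two_pow (n := d + 1); omega⟩
  have hk : 2 ≤ j + 1 := by
    rw [hj]; calc 2 = 2 ^ 1 := rfl
      _ ≤ 2 ^ (d + 1) := Nat.pow_le_pow_right (by omega) (by omega)
  set e : ℝ := 1 + 1 / ((d + 1 : ℕ) : ℝ) with he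
  have he1 : 1 ≤ e := by rw [he]; have : (0 : ℝ) ≤ 1 / ((d + 1 : ℕ) : ℝ) := by positivity
                         linarith
  have heε : e ≤ 1 + ε := by rw [he]; push_cast; linarith
  set k : ℝ := (2 : ℝ) ^ (d + 1) with hkdef
  have hk0 : 0 < k := by positivity
  refine ⟨max (8 * (3 * k) ^ e * (8 * k) ^ e) (4 * (10 * j + 7)), lt_max_of_lt_right (by positivity), ?_⟩
  intro n hn z h1 h3
  have hA := par_pos n
  have hc : 1 ≤ par n ^ 2 := Nat.one_le_pow _ _ hA
  have hn1 : (1 : ℝ) ≤ n := by exact_mod_cast (by omega : 1 ≤ n)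
  obtain ⟨x, hx, hx', h6, hx2, hl, hu⟩ := par_facts n (by omega)
  have hb := par_bounds n (by omega)
  set m := Nat.clog (j + 1) (par n * par n ^ 2) with hm
  set m' := Nat.clog (j + 1) (par n + 1) with hm'
  have hlog := one_le_log n hn
  have hml : (m : ℝ) ≤ 5 * Real.logb 2 n := clog_le_log _ _ n hk (Nat.mul_pos hA hc) hn hb.2
  have hml' : (m' : ℝ) ≤ 5 * Real.logb 2 n := clog_le_log _ _ n hk (by omega) hn hb.1
  have ht : (((2 * j + 1) ^ m : ℕ) : ℝ) ≤ (k * ((par n * par n ^ 2 : ℕ) : ℝ)) ^ e :=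
    time_le (d + 1) _ (by omega) (Nat.mul_pos hA hc) j hj
  have ht' : (((2 * j + 1) ^ m' : ℕ) : ℝ) ≤ (k * ((par n + 1 : ℕ) : ℝ)) ^ e :=
    time_le (d + 1) _ (by omega) (by omega) j hj
  have w := fast (par n) (par n ^ 2) _ j m m' hA hc (Nat.le_pow_clog (by omega) _)
    (Nat.le_pow_clog (by omega) _) z h1 h3 le_rfl
  obtain ⟨t, P, p1, p2, p3⟩ := toPebbling _ (edge_irrefl _ _) z _ _ w
  have hA2 : (par n : ℝ) ^ 2 ≤ 4 * x ^ 2 := by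
    have := pow_le_pow_left₀ (by positivity) hu 2
    linarith [show (2 * x) ^ 2 = 4 * x ^ 2 by ring]
  have hA3 : (par n : ℝ) * par n ^ 2 ≤ 8 * x ^ 3 := by
    have := pow_le_pow_left₀ (by positivity) hu 3
    linarith [show (2 * x) ^ 3 = 8 * x ^ 3 by ring, show (par n : ℝ) * par n ^ 2 = par n ^ 3 by ring]
  have hx0 : 0 < x := by linarith
  refine ⟨t, P, p1, ?_, ?_⟩
  · have q1 : (((2 * j + 1) ^ m : ℕ) : ℝ) ≤ (8 * k * x ^ 3) ^ e := by
      refine ht.trans (Real.rpow_le_rpow (by positivity) ?_ (by linarith))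
      push_cast
      nlinarith
    have q2 : (((2 * j + 1) ^ m' : ℕ) : ℝ) ≤ (3 * k * x) ^ e := by
      refine ht'.trans (Real.rpow_le_rpow (by positivity) ?_ (by linarith))
      push_cast
      nlinarith
    have q3 : (par n : ℝ) ^ 2 ≤ 4 * (x ^ 2) ^ e := by
      have : x ^ 2 ≤ (x ^ 2) ^ e := Real.self_le_rpow_of_one_le (one_le_pow₀ hx) he1
      linarith
    have p2' : (t : ℝ) ≤ 2 * ((((2 * j + 1) ^ m' : ℕ) : ℝ) * ((par n : ℝ) ^ 2 * (((2 * j + 1) ^ m : ℕ) : ℝ))) := by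
      exact_mod_cast p2
    calc (t : ℝ) ≤ _ := p2'
      _ ≤ 2 * ((3 * k * x) ^ e * ((4 * (x ^ 2) ^ e) * (8 * k * x ^ 3) ^ e)) := by
        gcongr
      _ = (8 * (3 * k) ^ e * (8 * k) ^ e) * (n : ℝ) ^ e := by
        rw [← h6, Real.mul_rpow (by positivity) (by positivity) (x := 3 * k),
          Real.mul_rpow (by positivity) (by positivity) (x := 8 * k),
          show x ^ 6 = x * x ^ 2 * x ^ 3 by ring,
          Real.mul_rpow (by positivity) (by positivity) (x := x * x ^ 2),
          Real.mul_rpow (by positivity) (by positivity) (x := x)]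
        ring
      _ ≤ _ := by
        apply mul_le_mul (le_max_left _ _) (Real.rpow_le_rpow_of_exponent_le hn1 heε)
          (by positivity) (le_max_of_le_right (by positivity))
  · have p3' : ((Gr (par n) (par n ^ 2)).space t P : ℝ) ≤
        ((m' : ℝ) * j + 2) * (par n : ℝ) ^ 2 + (par n : ℝ) ^ 2 + ((m : ℝ) * j + 2) := by
      exact_mod_cast p3
    have hc' : (1 : ℝ) ≤ (par n : ℝ) ^ 2 := by exact_mod_cast hc
    have hj0 : (0 : ℝ) ≤ j := by positivity
    have r1 : (m : ℝ) * j ≤ 5 * Real.logb 2 n * j := mul_le_mul_of_nonneg_right hml hj0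
    have r2 : (m' : ℝ) * j ≤ 5 * Real.logb 2 n * j := mul_le_mul_of_nonneg_right hml' hj0
    rw [← hx2]
    calc _ ≤ _ := p3'
      _ ≤ ((m' : ℝ) * j + 2) * (par n : ℝ) ^ 2 + (par n : ℝ) ^ 2 + ((m : ℝ) * j + 2) * (par n : ℝ) ^ 2 := by
        have : ((m : ℝ) * j + 2) * 1 ≤ ((m : ℝ) * j + 2) * (par n : ℝ) ^ 2 :=
          mul_le_mul_of_nonneg_left hc' (by positivity)
        linarith
      _ = (par n : ℝ) ^ 2 * ((m' : ℝ) * j + (m : ℝ) * j + 5) := by ring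
      _ ≤ (4 * x ^ 2) * ((10 * j + 7) * Real.logb 2 n) := by
        apply mul_le_mul hA2 _ (by positivity) (by positivity)
        linarith
      _ = (4 * (10 * j + 7)) * x ^ 2 * Real.logb 2 n := by ring
      _ ≤ _ := by
        gcongr
        exact le_max_right _ _
end RevPeb

/-- There is a family of single-sink DAGs `G_n` of in-degree at most 2 and
`Θ(n)` vertices such that: (1) the reversible pebbling price of `G_n` is `O(n^{1/6} log n)`;
(2) for every `ε > 0` there is a reversible pebbling of `G_n` with time `O(n^{1+ε})` and space
`O(n^{1/3} log n)`; (3) there is a `K > 0` such that every standard pebbling of `G_n` with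
space at most `K n^{1/3}` has time at least `⌊n^{1/6}⌋!`. -/
theorem reversible_pebbling_exp_tradeoff :
    ∃ (G : ℕ → FinDigraph) (z : ∀ n, (G n).V),
      (∀ n, (G n).Acyclic ∧ (G n).UniqueSink (z n) ∧ ∀ v, ((G n).pred v).ncard ≤ 2) ∧
      (∃ a b : ℝ, 0 < a ∧ 0 < b ∧ ∀ n : ℕ, 1 ≤ n →
        a * n ≤ (Fintype.card (G n).V : ℝ) ∧ (Fintype.card (G n).V : ℝ) ≤ b * n) ∧
      -- (1) reversible pebbling price O(n^{1/6} log n)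
      (∃ C : ℝ, 0 < C ∧ ∃ N : ℕ, ∀ n : ℕ, N ≤ n →
        ∃ t P, (G n).IsRevPebbling (z n) t P ∧
          ((G n).space t P : ℝ) ≤ C * (n : ℝ) ^ ((1 : ℝ) / 6) * Real.logb 2 n) ∧
      -- (2) reversible pebbling with time O(n^{1+ε}) and space O(n^{1/3} log n)
      (∀ ε : ℝ, 0 < ε → ∃ C : ℝ, 0 < C ∧ ∃ N : ℕ, ∀ n : ℕ, N ≤ n →
        ∃ t P, (G n).IsRevPebbling (z n) t P ∧
          (t : ℝ) ≤ C * (n : ℝ) ^ ((1 : ℝ) + ε) ∧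
          ((G n).space t P : ℝ) ≤ C * (n : ℝ) ^ ((1 : ℝ) / 3) * Real.logb 2 n) ∧
      -- (3) standard pebbling lower bound
      (∃ K : ℝ, 0 < K ∧ ∃ N : ℕ, ∀ n : ℕ, N ≤ n →
        ∀ t P, (G n).IsStdPebbling (z n) t P →
          ((G n).space t P : ℝ) ≤ K * (n : ℝ) ^ ((1 : ℝ) / 3) →
          Nat.factorial ⌊(n : ℝ) ^ ((1 : ℝ) / 6)⌋₊ ≤ t) := by
  classical
  have hpos : ∀ n, 1 ≤ RevPeb.par n ^ 2 := fun n => Nat.one_le_pow _ _ (RevPeb.par_pos n)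
  choose z hz1 hz3 using fun n =>
    RevPeb.exists_sink (RevPeb.par n) (RevPeb.par n ^ 2) (RevPeb.par_pos n) (hpos n)
  refine ⟨fun n => RevPeb.Gr (RevPeb.par n) (RevPeb.par n ^ 2), z, ?_, ?_, ?_, ?_, ?_⟩
  · intro n
    exact ⟨RevPeb.acyclic _ _, RevPeb.uniqueSink _ _ (RevPeb.par_pos n) (hpos n) _ (hz1 n) (hz3 n),
      RevPeb.indeg _ _⟩
  · refine ⟨1, 128, by norm_num, by norm_num, ?_⟩
    intro n hn
    obtain ⟨x, hx, _, h6, _, hl, hu⟩ := RevPeb.par_facts n hn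
    have h1 := RevPeb.le_card (RevPeb.par n) (RevPeb.par n ^ 2)
    have h2 := RevPeb.card_le (RevPeb.par n) (RevPeb.par n ^ 2)
    have hA := RevPeb.par_pos n
    change (1 : ℝ) * n ≤ (Fintype.card (RevPeb.Gr (RevPeb.par n) (RevPeb.par n ^ 2)).V : ℝ) ∧
      (Fintype.card (RevPeb.Gr (RevPeb.par n) (RevPeb.par n ^ 2)).V : ℝ) ≤ 128 * n
    generalize Fintype.card (RevPeb.Gr (RevPeb.par n) (RevPeb.par n ^ 2)).V = N at *
    generalize RevPeb.par n = A at *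
    constructor
    · have h1' : (A : ℝ) * ((A : ℝ) ^ 2 * (A * (A : ℝ) ^ 2)) ≤
          (N : ℝ) := by exact_mod_cast h1
      have := pow_le_pow_left₀ (by linarith) hl.le 6
      linarith [show (A : ℝ) * ((A : ℝ) ^ 2 * (A * (A : ℝ) ^ 2)) = A ^ 6 by ring]
    · have h2' : (N : ℝ) ≤
          ((A : ℝ) + 1) * ((A : ℝ) ^ 2 * (A * (A : ℝ) ^ 2)) := by exact_mod_cast h2
      have := pow_le_pow_left₀ (by positivity) hu 6
      have hA' : (1 : ℝ) ≤ A := by exact_mod_cast hA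
      have h5 : (A : ℝ) ^ 5 * 1 ≤ (A : ℝ) ^ 5 * A := mul_le_mul_of_nonneg_left hA' (by positivity)
      linarith [show ((A : ℝ) + 1) * ((A : ℝ) ^ 2 * (A * (A : ℝ) ^ 2)) = A ^ 6 + A ^ 5 by ring,
        show (A : ℝ) ^ 5 * A = A ^ 6 by ring, show (2 * x) ^ 6 = 64 * x ^ 6 by ring]
  · exact ⟨24, by norm_num, 2, fun n hn => RevPeb.main_price n hn (z n) (hz1 n) (hz3 n)⟩
  · intro ε hε
    obtain ⟨C, hC, h⟩ := RevPeb.main_fast ε hε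
    exact ⟨C, hC, 2, fun n hn => h n hn (z n) (hz1 n) (hz3 n)⟩
  · refine ⟨1, by norm_num, 1, ?_⟩
    intro n hn t P hP hs
    obtain ⟨x, hx, _, h6, hx2, hl, hu⟩ := RevPeb.par_facts n hn
    have hA := RevPeb.par_pos n
    have hlt : (RevPeb.Gr (RevPeb.par n) (RevPeb.par n ^ 2)).space t P < RevPeb.par n ^ 2 := by
      rw [← hx2, one_mul] at hs
      have h2 : x ^ 2 < (RevPeb.par n : ℝ) ^ 2 := pow_lt_pow_left₀ hl (by linarith) (by norm_num)
      have h3 := lt_of_le_of_lt hs h2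
      exact_mod_cast h3
    have := RevPeb.lower _ _ hA (hpos n) (z n) (hz1 n) (hz3 n) P t hP hlt
    refine le_trans ?_ this
    refine le_trans (Nat.factorial_le ?_) (Nat.factorial_le_pow _)
    unfold RevPeb.par
    omega
end
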